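/- Let d ≥ 3 be an integer and let a > -((d-2)/2)² be real. Let W denote the ground state soliton W_{min(a,0)} and set K := Q_{min(a,0)}(W) = ∫_{ℝ^d}(|∇W|² + (min(a,0)/|x|²)W²) dx. Then for every f ∈ C_c^∞(ℝ^d \ {0}; ℂ), writing y := Q_a(f)/K, one has 2E_a(f)/K ≥ y - ((d-2)/d) · y^{d/(d-2)}, where Q_a(f) := ∫_{ℝ^d}(|∇f|² + (a/|x|²)|f|²) dx and E_a(f) := (1/2)Q_a(f) - ((d-2)/(2d))∫_{ℝ^d}|f|^{2d/(d-2)} dx. -/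

import Mathlib

open MeasureTheory

theorem succ_mul_le_add_mul_of_pow_eq {x y z : ℝ} (hy : 0 < y) (hz : 0 ≤ z) (l : ℕ)
    (h : z ^ (l + 1) = x * y ^ l) : (l + 1) * z ≤ x + l * y := by
  have hb := one_add_mul_le_pow (a := z / y - 1) (by
    have : 0 ≤ z / y := by positivity
    linarith) (l + 1)
  have hx : (1 + (z / y - 1)) ^ (l + 1) = x / y := by
    rw [add_sub_cancel, div_pow, h, pow_succ]
    field_simp
  rw [hx] at hb
  have hb' := mul_le_mul_of_nonneg_right hb hy.le
  rw [div_mul_cancel₀ _ hy.ne'] at hb'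
  have e : (1 + ((l + 1 : ℕ) : ℝ) * (z / y - 1)) * y = (l + 1) * z - l * y := by
    push_cast
    field_simp
    ring
  linarith

theorem add_mul_pow_succ_le {s t p q r : ℝ} (hs : 0 < s) (ht : 0 ≤ t) (hp : 0 < p) (hq : 0 < q)
    (hr : 0 ≤ r) (l : ℕ) (h : r ^ (l + 1) = p * q ^ l) :
    (s + t * r) ^ (l + 1) ≤ (s + t * p) * (s + t * q) ^ l := by
  have hA : 0 < s + t * p := by positivity
  have hB : 0 < s + t * q := by positivity
  set A := s + t * p
  set B := s + t * q
  obtain ⟨D, hD, hDl⟩ : ∃ D : ℝ, 0 < D ∧ D ^ (l + 1) = A * B ^ l :=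
    ⟨(A * B ^ l) ^ (((l + 1 : ℕ) : ℝ)⁻¹), by positivity,
      Real.rpow_inv_natCast_pow (by positivity) (by omega)⟩
  rw [← hDl]
  have h1 := succ_mul_le_add_mul_of_pow_eq (x := s / A) (y := s / B) (z := s / D)
    (by positivity) (by positivity) l (by
      rw [div_pow, hDl, div_pow, pow_succ]
      field_simp)
  rcases ht.eq_or_lt with rfl | ht
  · have : A = s ∧ B = s := by simp [A, B]
    rw [hDl, this.1, this.2]
    simp [pow_succ, mul_comm]
  have h2 := succ_mul_le_add_mul_of_pow_eq (x := t * p / A) (y := t * q / B) (z := t * r / D)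
    (by positivity) (by positivity) l (by
      rw [div_pow, hDl, div_pow, mul_pow, h, pow_succ, mul_pow]
      field_simp)
  have e1 : s / A + t * p / A = 1 := by rw [← add_div]; exact div_self hA.ne'
  have e2 : s / B + t * q / B = 1 := by rw [← add_div]; exact div_self hB.ne'
  have h3 : ((l : ℝ) + 1) * ((s + t * r) / D) ≤ l + 1 := by
    calc ((l : ℝ) + 1) * ((s + t * r) / D) = (l + 1) * (s / D) + (l + 1) * (t * r / D) := by ring
      _ ≤ (s / A + l * (s / B)) + (t * p / A + l * (t * q / B)) := add_le_add h1 h2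
      _ = (s / A + t * p / A) + l * (s / B + t * q / B) := by ring
      _ = l + 1 := by rw [e1, e2]; ring
  have h4 : (s + t * r) / D ≤ 1 := by
    by_contra hc
    push Not at hc
    have : ((l : ℝ) + 1) * 1 < ((l : ℝ) + 1) * ((s + t * r) / D) := by gcongr
    linarith
  have h5 : s + t * r ≤ D := by rwa [div_le_one hD] at h4
  gcongr

/-- Monotone transport of one positive continuous density on the line to another. -/
theorem exists_transport {a b : ℝ → ℝ} (ha : Continuous a) (hb : Continuous b)
    (ha0 : ∀ x, 0 < a x) (hb0 : ∀ x, 0 < b x) (hai : Integrable a) (hbi : Integrable b)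
    (hab : ∫ x, a x = ∫ x, b x) :
    ∃ T : ℝ → ℝ, StrictMono T ∧ Function.Surjective T ∧
      ∀ x, HasDerivAt T (a x / b (T x)) x := by
  have key : ∀ c : ℝ → ℝ, Continuous c → (∀ x, 0 < c x) → Integrable c →
      ∃ F : ℝ → ℝ, StrictMono F ∧ (∀ x, HasDerivAt F (c x) x) ∧
        Set.range F = Set.Ioo 0 (∫ x, c x) := by
    intro c hc hc0 hci
    have hd : ∀ x, HasDerivAt (fun x => ∫ y in Set.Iic x, c y) (c x) x := by
      intro x
      have : (fun x => ∫ y in Set.Iic x, c y) =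
          fun x => (∫ y in (0:ℝ)..x, c y) + ∫ y in Set.Iic 0, c y := by
        ext x
        rw [intervalIntegral.integral_Iic_sub_Iic hci.integrableOn hci.integrableOn |>.symm]
        ring
      rw [this]
      exact (hc.integral_hasStrictDerivAt 0 x).hasDerivAt.add_const _
    have hm : StrictMono (fun x => ∫ y in Set.Iic x, c y) :=
      strictMono_of_deriv_pos (fun x => by rw [(hd x).deriv]; exact hc0 x)
    have hbot : Filter.Tendsto (fun x => ∫ y in Set.Iic x, c y) Filter.atBot (nhds 0) := by
      have := intervalIntegral_tendsto_integral_Iic (0:ℝ) hci.integrableOn Filter.tendsto_id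
      have h2 := (this.const_sub (∫ y in Set.Iic 0, c y))
      rw [sub_self] at h2
      refine h2.congr fun x => ?_
      rw [id, ← intervalIntegral.integral_Iic_sub_Iic hci.integrableOn hci.integrableOn]
      ring
    have htop : Filter.Tendsto (fun x => ∫ y in Set.Iic x, c y) Filter.atTop
        (nhds (∫ x, c x)) := by
      have := intervalIntegral_tendsto_integral_Ioi (0:ℝ) hci.integrableOn Filter.tendsto_id
      have h2 := (this.const_add (∫ y in Set.Iic 0, c y))
      rw [intervalIntegral.integral_Iic_add_Ioi hci.integrableOn hci.integrableOn] at h2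
      refine h2.congr fun x => ?_
      rw [id, ← intervalIntegral.integral_Iic_sub_Iic hci.integrableOn hci.integrableOn]
      ring
    refine ⟨_, hm, hd, Set.Subset.antisymm ?_ ?_⟩
    · rintro _ ⟨x, rfl⟩
      constructor
      · exact lt_of_le_of_lt (hm.monotone.le_of_tendsto hbot (x - 1)) (hm (sub_one_lt x))
      · exact lt_of_lt_of_le (hm (lt_add_one x)) (hm.monotone.ge_of_tendsto htop (x + 1))
    · intro z hz
      have hcont : Continuous (fun x => ∫ y in Set.Iic x, c y) :=
        continuous_iff_continuousAt.2 fun x => (hd x).continuousAt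
      obtain ⟨x, hx⟩ := (hbot.eventually (gt_mem_nhds hz.1)).exists
      obtain ⟨y, hy⟩ := (htop.eventually (lt_mem_nhds hz.2)).exists
      exact mem_range_of_exists_le_of_exists_ge hcont ⟨x, hx.le⟩ ⟨y, hy.le⟩
  obtain ⟨F, hF, hFd, hFr⟩ := key a ha ha0 hai
  obtain ⟨G, hG, hGd, hGr⟩ := key b hb hb0 hbi
  have hFG : ∀ x, ∃ y, G y = F x := fun x => by
    have : F x ∈ Set.range G := by rw [hGr, ← hab, ← hFr]; exact ⟨x, rfl⟩
    exact this
  choose T hT using hFG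
  have hTm : StrictMono T := fun x y hxy => hG.lt_iff_lt.1 (by rw [hT, hT]; exact hF hxy)
  have hTs : Function.Surjective T := fun y => by
    have : G y ∈ Set.range F := by rw [hFr, hab, ← hGr]; exact ⟨y, rfl⟩
    obtain ⟨x, hx⟩ := this
    exact ⟨x, hG.injective (by rw [hT, hx])⟩
  refine ⟨T, hTm, hTs, fun x => ?_⟩
  have hTc : Continuous T := hTm.monotone.continuous_of_surjective hTs
  rw [hasDerivAt_iff_tendsto_slope]
  have h1 := hasDerivAt_iff_tendsto_slope.1 (hFd x)
  have h2 := hasDerivAt_iff_tendsto_slope.1 (hGd (T x))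
  have h3 : Filter.Tendsto T (nhdsWithin x {x}ᶜ) (nhdsWithin (T x) {T x}ᶜ) :=
    (hTc.tendsto x).inf (Filter.tendsto_principal_principal.2 fun y hy h =>
      hy (hTm.injective h))
  refine (h1.div (h2.comp h3) (hb0 _).ne').congr' ?_
  filter_upwards [self_mem_nhdsWithin] with y hy
  have hne : F y - F x ≠ 0 := sub_ne_zero.2 (hF.injective.ne hy)
  have hne' : T y - T x ≠ 0 := sub_ne_zero.2 (hTm.injective.ne hy)
  have hyx : y - x ≠ 0 := sub_ne_zero.2 hy
  simp only [Function.comp, Pi.div_apply, slope_def_field, hT]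
  field_simp

theorem lintegral_fin_succ {k : ℕ} {F : (Fin (k + 1) → ℝ) → ENNReal} (hF : Measurable F) :
    ∫⁻ x, F x = ∫⁻ r : ℝ, ∫⁻ z : Fin k → ℝ, F (Fin.cons r z) := by
  have h := (volume_preserving_piFinSuccAbove (fun _ : Fin (k + 1) => ℝ) 0).symm
  have h2 := lintegral_prod (μ := (volume : Measure ℝ)) (ν := (volume : Measure (Fin k → ℝ))) _
    (hF.comp (MeasurableEquiv.piFinSuccAbove (fun _ : Fin (k + 1) => ℝ) 0).symm.measurable).aemeasurable
  rw [← h.lintegral_comp hF]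
  refine h2.trans ?_
  simp [MeasurableEquiv.piFinSuccAbove, Fin.insertNthEquiv]

theorem integral_fin_succ {k : ℕ} {F : (Fin (k + 1) → ℝ) → ℝ} (hF : Integrable F) :
    Integrable (fun r : ℝ => ∫ z : Fin k → ℝ, F (Fin.cons r z)) ∧
      ∫ x, F x = ∫ r : ℝ, ∫ z : Fin k → ℝ, F (Fin.cons r z) := by
  have h := (volume_preserving_piFinSuccAbove (fun _ : Fin (k + 1) => ℝ) 0).symm
  have hi : Integrable (F ∘ (MeasurableEquiv.piFinSuccAbove (fun _ : Fin (k + 1) => ℝ) 0).symm) :=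
    (h.integrable_comp_emb (MeasurableEquiv.measurableEmbedding _)).2 hF
  have h1 := hi.integral_prod_left
  have h2 := integral_prod _ hi
  have h3 := h.integral_comp' F
  constructor
  · simpa [MeasurableEquiv.piFinSuccAbove, Fin.insertNthEquiv] using h1
  · rw [← h3]
    refine h2.trans ?_
    simp [MeasurableEquiv.piFinSuccAbove, Fin.insertNthEquiv]

theorem continuous_fin_cons {k : ℕ} :
    Continuous fun p : ℝ × (Fin k → ℝ) => (Fin.cons p.1 p.2 : Fin (k + 1) → ℝ) := by
  refine continuous_pi fun i => ?_
  refine Fin.cases ?_ (fun j => ?_) i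
  · simpa using continuous_fst
  · simp only [Fin.cons_succ]
    fun_prop

theorem norm_le_norm_fin_cons {k : ℕ} (r : ℝ) (z : Fin k → ℝ) :
    ‖z‖ ≤ ‖(Fin.cons r z : Fin (k + 1) → ℝ)‖ := by
  refine (pi_norm_le_iff_of_nonneg (norm_nonneg _)).2 fun i => ?_
  simpa using norm_le_pi_norm (Fin.cons r z : Fin (k + 1) → ℝ) i.succ

section Decay

variable {E : Type*} [NormedAddCommGroup E] [NormedSpace ℝ E] [FiniteDimensional ℝ E]
  [MeasurableSpace E] [BorelSpace E]

theorem integrable_inv_one_add_norm_sq_pow (ν : Measure E) [ν.IsAddHaarMeasure] {n : ℕ}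
    (hn : Module.finrank ℝ E < 2 * n) : Integrable (fun x : E => ((1 + ‖x‖ ^ 2) ^ n)⁻¹) ν := by
  have := integrable_rpow_neg_one_add_norm_sq (E := E) (μ := ν) (r := 2 * n) (by exact_mod_cast hn)
  refine this.congr (Filter.Eventually.of_forall fun x => ?_)
  have hp : 0 < 1 + ‖x‖ ^ 2 := by positivity
  simp only
  rw [show (-(2 * (n : ℝ)) / 2) = -(n : ℝ) by ring, Real.rpow_neg hp.le, Real.rpow_natCast]

theorem inv_pow_le_of_mul_le {c u w : ℝ} (hc : 0 < c) (hw : 0 < w) (h : c * w ≤ u) (n : ℕ) :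
    (u ^ n)⁻¹ ≤ (c ^ n)⁻¹ * (w ^ n)⁻¹ := by
  rw [← mul_inv, ← mul_pow]
  exact inv_anti₀ (by positivity) (pow_le_pow_left₀ (by positivity) h n)

theorem integrable_inv_pow_of_le (ν : Measure E) [ν.IsAddHaarMeasure] {n : ℕ}
    (hn : Module.finrank ℝ E < 2 * n) {u : E → ℝ} (hu : Continuous u) {c : ℝ} (hc : 0 < c)
    (hcu : ∀ x, c * (1 + ‖x‖ ^ 2) ≤ u x) : Integrable (fun x => (u x ^ n)⁻¹) ν := by
  have hpos : ∀ x, 0 < u x := fun x => lt_of_lt_of_le (by positivity) (hcu x)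
  refine ((integrable_inv_one_add_norm_sq_pow ν hn).const_mul ((c ^ n)⁻¹)).mono'
    (Continuous.aestronglyMeasurable (Continuous.inv₀ (by fun_prop)
      fun x => (pow_pos (hpos x) n).ne')) (Filter.Eventually.of_forall fun x => ?_)
  have := hpos x
  rw [Real.norm_of_nonneg (by positivity)]
  exact inv_pow_le_of_mul_le hc (by positivity) (hcu x) n

end Decay

theorem integral_inv_pow_pos {k n : ℕ} (hn : k < 2 * n) {u : (Fin k → ℝ) → ℝ} (hu : Continuous u)
    {c : ℝ} (hc : 0 < c) (hcu : ∀ x, c * (1 + ‖x‖ ^ 2) ≤ u x) : 0 < ∫ x, (u x ^ n)⁻¹ := by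
  have hpos : ∀ x, 0 < u x := fun x => lt_of_lt_of_le (by positivity) (hcu x)
  refine integral_pos_of_integrable_nonneg_nonzero (x := 0)
    (Continuous.inv₀ (by fun_prop) fun x => (pow_pos (hpos x) n).ne')
    (integrable_inv_pow_of_le volume (by simpa using hn) hu hc hcu)
    (fun x => inv_nonneg.2 (pow_pos (hpos x) n).le) (inv_pos.2 (pow_pos (hpos 0) n)).ne'

theorem continuous_integral_inv_pow_fin_cons {k n : ℕ} (hn : k < 2 * n)
    {u : (Fin (k + 1) → ℝ) → ℝ} (hu : Continuous u) {c : ℝ} (hc : 0 < c)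
    (hcu : ∀ x, c * (1 + ‖x‖ ^ 2) ≤ u x) :
    Continuous fun r : ℝ => ∫ z : Fin k → ℝ, (u (Fin.cons r z) ^ n)⁻¹ := by
  have hpos : ∀ x, 0 < u x := fun x => lt_of_lt_of_le (by positivity) (hcu x)
  have hc2 : Continuous fun p : ℝ × (Fin k → ℝ) => (u (Fin.cons p.1 p.2) ^ n)⁻¹ :=
    Continuous.inv₀ ((hu.comp continuous_fin_cons).pow n) fun p => (pow_pos (hpos _) n).ne'
  refine continuous_of_dominated (bound := fun z => (c ^ n)⁻¹ * ((1 + ‖z‖ ^ 2) ^ n)⁻¹)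
    (fun r => (hc2.comp (Continuous.prodMk_right r)).aestronglyMeasurable)
    (fun r => Filter.Eventually.of_forall fun z => ?_)
    ((integrable_inv_one_add_norm_sq_pow volume (by simpa using hn)).const_mul _)
    (Filter.Eventually.of_forall fun z => hc2.comp (Continuous.prodMk_left z))
  have := hpos (Fin.cons r z)
  rw [Real.norm_of_nonneg (by positivity)]
  refine inv_pow_le_of_mul_le hc (by positivity) (le_trans ?_ (hcu _)) n
  have := norm_le_norm_fin_cons r z
  gcongr

/-- A dimensional refinement of the Borell–Brascamp–Lieb inequality at the exponent `1 - n`,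
for functions on `ℝ^k`, `k ≤ n`, by induction on `k` through one-dimensional transport. -/
theorem borell_brascamp_lieb_inv_pow {n : ℕ} (hn : 1 ≤ n) {t : ℝ} (ht0 : 0 < t) (ht1 : t < 1)
    (k : ℕ) (hk : k ≤ n) (u v H : (Fin k → ℝ) → ℝ) {cu cv : ℝ} (hcu : 0 < cu) (hcv : 0 < cv)
    (hu : Continuous u) (hv : Continuous v)
    (hul : ∀ x, cu * (1 + ‖x‖ ^ 2) ≤ u x) (hvl : ∀ x, cv * (1 + ‖x‖ ^ 2) ≤ v x)
    (hHm : Measurable H) (hH0 : ∀ x, 0 < H x)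
    (hH : ∀ x y, H ((1 - t) • x + t • y) ≤ (1 - t) * u x + t * v y)
    {μ : ℝ} (hμ : 0 < μ) (huv : ∫ x, (u x ^ n)⁻¹ = μ ^ (n - k) * ∫ x, (v x ^ n)⁻¹) :
    ENNReal.ofReal (1 - t) * (∫⁻ x, ENNReal.ofReal (u x ^ (n - 1))⁻¹) +
        ENNReal.ofReal (t * μ ^ (n - k)) * (∫⁻ x, ENNReal.ofReal (v x ^ (n - 1))⁻¹) ≤
      ENNReal.ofReal ((1 - t + t * μ) ^ (n - k)) * ∫⁻ x, ENNReal.ofReal (H x ^ (n - 1))⁻¹ := by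
  have ht1' : 0 < 1 - t := by linarith
  induction k generalizing μ with
  | zero =>
    have hI : ∀ w : (Fin 0 → ℝ) → ℝ, ∫ x, w x = w 0 := fun w => by
      rw [volume_pi, Measure.pi_of_empty, integral_dirac]
      exact congrArg w (Subsingleton.elim _ _)
    have hL : ∀ w : (Fin 0 → ℝ) → ENNReal, ∫⁻ x, w x = w 0 := fun w => by
      rw [volume_pi, Measure.pi_of_empty, lintegral_dirac]
      exact congrArg w (Subsingleton.elim _ _)
    rw [hI, hI] at huv
    rw [hL, hL, hL]
    have hp : 0 < u 0 := lt_of_lt_of_le (by positivity) (hul 0)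
    have hq : 0 < v 0 := lt_of_lt_of_le (by positivity) (hvl 0)
    have hr := hH0 0
    have hh := hH 0 0
    simp only [smul_zero, add_zero, tsub_zero] at hh huv ⊢
    generalize u 0 = p at *
    generalize v 0 = q at *
    generalize H 0 = r at *
    have hqp : q = μ * p := by
      have h1 : q ^ n = (μ * p) ^ n := by
        rw [mul_pow]
        field_simp at huv
        linarith
      exact (pow_left_inj₀ hq.le (by positivity) (by omega)).1 h1
    subst hqp
    rw [← ENNReal.ofReal_mul (by positivity), ← ENNReal.ofReal_mul (by positivity),
      ← ENNReal.ofReal_mul (by positivity), ← ENNReal.ofReal_add (by positivity) (by positivity)]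
    refine ENNReal.ofReal_le_ofReal ?_
    obtain ⟨m, rfl⟩ : ∃ m, n = m + 1 := ⟨n - 1, by omega⟩
    simp only [Nat.add_sub_cancel]
    have hle : r ≤ (1 - t + t * μ) * p := by linarith
    calc (1 - t) * (p ^ m)⁻¹ + t * μ ^ (m + 1) * ((μ * p) ^ m)⁻¹
        = (1 - t + t * μ) ^ (m + 1) * (((1 - t + t * μ) * p) ^ m)⁻¹ := by
          have : 0 < 1 - t + t * μ := by positivity
          rw [mul_pow, mul_pow, pow_succ, pow_succ]
          field_simp
      _ ≤ _ := by gcongr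
  | succ k ih =>
    obtain ⟨m, hm⟩ : ∃ m, n = m + (k + 1) := ⟨n - (k + 1), by omega⟩
    have e1 : n - (k + 1) = m := by omega
    have e2 : n - k = m + 1 := by omega
    rw [e1] at huv ⊢
    rw [e2] at ih
    have hu0 : ∀ x, 0 < u x := fun x => lt_of_lt_of_le (by positivity) (hul x)
    have hv0 : ∀ x, 0 < v x := fun x => lt_of_lt_of_le (by positivity) (hvl x)
    have hcons : ∀ r : ℝ, Continuous fun z : Fin k → ℝ => (Fin.cons r z : Fin (k + 1) → ℝ) :=
      fun r => continuous_fin_cons.comp (Continuous.prodMk_right r)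
    have hsl : ∀ {w : (Fin (k + 1) → ℝ) → ℝ} {c : ℝ}, 0 < c → (∀ x, c * (1 + ‖x‖ ^ 2) ≤ w x) →
        ∀ r (z : Fin k → ℝ), c * (1 + ‖z‖ ^ 2) ≤ w (Fin.cons r z) := fun hc hw r z => by
      refine le_trans ?_ (hw _)
      have := norm_le_norm_fin_cons r z
      gcongr
    set A : ℝ → ℝ := fun r => ∫ z : Fin k → ℝ, (u (Fin.cons r z) ^ n)⁻¹ with hA
    set B : ℝ → ℝ := fun r => ∫ z : Fin k → ℝ, (v (Fin.cons r z) ^ n)⁻¹ with hB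
    have hA0 : ∀ r, 0 < A r := fun r =>
      integral_inv_pow_pos (by omega) (hu.comp (hcons r)) hcu (hsl hcu hul r)
    have hB0 : ∀ r, 0 < B r := fun r =>
      integral_inv_pow_pos (by omega) (hv.comp (hcons r)) hcv (hsl hcv hvl r)
    obtain ⟨hAi, hAe⟩ := integral_fin_succ
      (integrable_inv_pow_of_le volume (n := n) (by simp; omega) hu hcu hul)
    obtain ⟨hBi, hBe⟩ := integral_fin_succ
      (integrable_inv_pow_of_le volume (n := n) (by simp; omega) hv hcv hvl)
    obtain ⟨T, hTm, hTs, hTd⟩ := exists_transport (a := A) (b := fun r => μ ^ m * B r)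
      (continuous_integral_inv_pow_fin_cons (by omega) hu hcu hul)
      ((continuous_integral_inv_pow_fin_cons (by omega) hv hcv hvl).const_mul _)
      hA0 (fun r => mul_pos (by positivity) (hB0 r)) hAi (hBi.const_mul _) (by
        rw [integral_const_mul, ← hAe, ← hBe, huv])
    set l : ℝ → ℝ := fun x => A x / (μ ^ m * B (T x)) with hl
    have hl0 : ∀ x, 0 < l x := fun x => div_pos (hA0 x) (mul_pos (by positivity) (hB0 _))
    have hmeas : ∀ {w : (Fin (k + 1) → ℝ) → ℝ}, Measurable w →
        Measurable (fun x => ENNReal.ofReal (w x ^ (n - 1))⁻¹) := fun hw =>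
      ((hw.pow_const _).inv).ennreal_ofReal
    have hmeas1 : ∀ {w : (Fin (k + 1) → ℝ) → ℝ}, Measurable w →
        Measurable fun r => ∫⁻ z : Fin k → ℝ, ENNReal.ofReal (w (Fin.cons r z) ^ (n - 1))⁻¹ :=
      fun hw => ((hmeas hw).comp continuous_fin_cons.measurable).lintegral_prod_right'
    rw [lintegral_fin_succ (hmeas hu.measurable), lintegral_fin_succ (hmeas hv.measurable),
      lintegral_fin_succ (hmeas hHm)]
    have hU1 := hmeas1 hu.measurable
    have hV1 := hmeas1 hv.measurable
    set U1 : ℝ → ENNReal := fun r => ∫⁻ z : Fin k → ℝ, ENNReal.ofReal (u (Fin.cons r z) ^ (n - 1))⁻¹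
    set V1 : ℝ → ENNReal := fun r => ∫⁻ z : Fin k → ℝ, ENNReal.ofReal (v (Fin.cons r z) ^ (n - 1))⁻¹
    set H1 : ℝ → ENNReal := fun r => ∫⁻ z : Fin k → ℝ, ENNReal.ofReal (H (Fin.cons r z) ^ (n - 1))⁻¹
    have cvV : ∫⁻ y, V1 y = ∫⁻ x, ENNReal.ofReal (l x) * V1 (T x) := by
      have := lintegral_image_eq_lintegral_abs_deriv_mul MeasurableSet.univ
        (fun x _ => (hTd x).hasDerivWithinAt) hTm.injective.injOn V1
      rw [Set.image_univ, hTs.range_eq, setLIntegral_univ, setLIntegral_univ] at this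
      rw [this]
      exact lintegral_congr fun x => by rw [abs_of_pos (hl0 x)]
    have cvH : ∫⁻ x, ENNReal.ofReal (1 - t + t * l x) * H1 ((1 - t) * x + t * T x) ≤
        ∫⁻ y, H1 y := by
      have hSd : ∀ x, HasDerivAt (fun x => (1 - t) * x + t * T x) (1 - t + t * l x) x := fun x => by
        have h := ((hasDerivAt_id' x).const_mul (1 - t)).fun_add ((hTd x).const_mul t)
        rwa [mul_one] at h
      have hSm : StrictMono fun x => (1 - t) * x + t * T x := fun x y hxy => by
        have := hTm hxy
        simp only
        gcongr
      have := lintegral_image_eq_lintegral_abs_deriv_mul MeasurableSet.univ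
        (fun x _ => (hSd x).hasDerivWithinAt) hSm.injective.injOn H1
      rw [setLIntegral_univ] at this
      calc _ = ∫⁻ x, ENNReal.ofReal |1 - t + t * l x| * H1 ((1 - t) * x + t * T x) :=
            lintegral_congr fun x => by
              rw [abs_of_pos (by have := hl0 x; positivity)]
        _ = _ := this.symm
        _ ≤ _ := setLIntegral_le_lintegral _ _
    have hpt : ∀ x, ENNReal.ofReal (1 - t) * U1 x +
        ENNReal.ofReal (t * μ ^ m) * (ENNReal.ofReal (l x) * V1 (T x)) ≤
        ENNReal.ofReal ((1 - t + t * μ) ^ m) *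
          (ENNReal.ofReal (1 - t + t * l x) * H1 ((1 - t) * x + t * T x)) := fun x => by
      have hlx := hl0 x
      obtain ⟨ν, hν, hνl⟩ : ∃ ν : ℝ, 0 < ν ∧ ν ^ (m + 1) = l x * μ ^ m :=
        ⟨(l x * μ ^ m) ^ (((m + 1 : ℕ) : ℝ)⁻¹), by positivity,
          Real.rpow_inv_natCast_pow (by positivity) (by omega)⟩
      have hslice := ih (by omega) (fun z => u (Fin.cons x z)) (fun z => v (Fin.cons (T x) z))
        (fun z => H (Fin.cons ((1 - t) * x + t * T x) z)) (hu.comp (hcons _)) (hv.comp (hcons _))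
        (hsl hcu hul x) (hsl hcv hvl (T x)) (hHm.comp (hcons _).measurable) (fun z => hH0 _)
        (fun z z' => by
          refine le_trans (le_of_eq ?_) (hH (Fin.cons x z) (Fin.cons (T x) z'))
          congr 1
          ext i
          refine Fin.cases ?_ (fun j => ?_) i <;> simp)
        hν (by
          rw [hνl]
          change A x = l x * μ ^ m * B (T x)
          have := hB0 (T x)
          simp only [hl]
          field_simp)
      rw [hνl] at hslice
      rw [← mul_assoc, ← ENNReal.ofReal_mul (by positivity), ← mul_assoc,
        ← ENNReal.ofReal_mul (by positivity)]
      refine le_trans (le_of_eq ?_) (hslice.trans ?_)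
      · rw [show t * μ ^ m * l x = t * (l x * μ ^ m) by ring]
      · refine mul_le_mul_left (ENNReal.ofReal_le_ofReal ?_) _
        rw [mul_comm ((1 - t + t * μ) ^ m)]
        exact add_mul_pow_succ_le ht1' ht0.le hlx hμ hν.le m hνl
    calc ENNReal.ofReal (1 - t) * (∫⁻ x, U1 x) + ENNReal.ofReal (t * μ ^ m) * ∫⁻ y, V1 y
        = ∫⁻ x, (ENNReal.ofReal (1 - t) * U1 x +
            ENNReal.ofReal (t * μ ^ m) * (ENNReal.ofReal (l x) * V1 (T x))) := by
          rw [cvV, lintegral_add_left (hU1.const_mul _),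
            lintegral_const_mul' _ _ ENNReal.ofReal_ne_top,
            lintegral_const_mul' _ _ ENNReal.ofReal_ne_top]
      _ ≤ _ := lintegral_mono hpt
      _ = _ := lintegral_const_mul' _ _ ENNReal.ofReal_ne_top
      _ ≤ _ := by gcongr

theorem borell_brascamp_lieb_euclideanSpace {n : ℕ} (hn : 3 ≤ n) {t : ℝ} (ht0 : 0 < t) (ht1 : t < 1)
    (u v H : EuclideanSpace ℝ (Fin n) → ℝ) {cu cv cH : ℝ} (hcu : 0 < cu) (hcv : 0 < cv)
    (hcH : 0 < cH) (hu : Continuous u) (hv : Continuous v) (hHc : Continuous H)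
    (hul : ∀ x, cu * (1 + ‖x‖ ^ 2) ≤ u x) (hvl : ∀ x, cv * (1 + ‖x‖ ^ 2) ≤ v x)
    (hHl : ∀ x, cH * (1 + ‖x‖ ^ 2) ≤ H x)
    (hH : ∀ x y, H ((1 - t) • x + t • y) ≤ (1 - t) * u x + t * v y)
    (huv : ∫ x, (u x ^ n)⁻¹ = ∫ x, (v x ^ n)⁻¹) :
    (1 - t) * (∫ x, (u x ^ (n - 1))⁻¹) + t * (∫ x, (v x ^ (n - 1))⁻¹) ≤
      ∫ x, (H x ^ (n - 1))⁻¹ := by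
  have hvol := PiLp.volume_preserving_toLp (Fin n)
  have hemb : MeasurableEmbedding (WithLp.toLp 2 : (Fin n → ℝ) → EuclideanSpace ℝ (Fin n)) :=
    (MeasurableEquiv.toLp 2 (Fin n → ℝ)).measurableEmbedding
  have hcont : Continuous (WithLp.toLp 2 : (Fin n → ℝ) → EuclideanSpace ℝ (Fin n)) :=
    PiLp.continuous_toLp 2 _
  have hle : ∀ {w : EuclideanSpace ℝ (Fin n) → ℝ} {c : ℝ}, 0 < c →
      (∀ x, c * (1 + ‖x‖ ^ 2) ≤ w x) → ∀ z : Fin n → ℝ, c * (1 + ‖z‖ ^ 2) ≤ w (WithLp.toLp 2 z) :=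
    fun hc hw z => by
      refine le_trans ?_ (hw _)
      have : ‖z‖ ≤ ‖WithLp.toLp 2 z‖ := (pi_norm_le_iff_of_nonneg (norm_nonneg _)).2 fun i =>
        PiLp.norm_apply_le (WithLp.toLp 2 z) i
      gcongr
  have h := borell_brascamp_lieb_inv_pow (by omega : 1 ≤ n) ht0 ht1 n le_rfl
    (fun z => u (WithLp.toLp 2 z)) (fun z => v (WithLp.toLp 2 z)) (fun z => H (WithLp.toLp 2 z))
    hcu hcv (hu.comp hcont) (hv.comp hcont) (hle hcu hul) (hle hcv hvl)
    (hHc.comp hcont).measurable (fun z => lt_of_lt_of_le (by positivity) (hHl _))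
    (fun x y => by simpa using hH (WithLp.toLp 2 x) (WithLp.toLp 2 y)) one_pos (by
      rw [Nat.sub_self, pow_zero, one_mul]
      have h1 := hvol.integral_comp hemb (fun x => (u x ^ n)⁻¹)
      have h2 := hvol.integral_comp hemb (fun x => (v x ^ n)⁻¹)
      rw [h1, h2, huv])
  have hlint : ∀ {w : EuclideanSpace ℝ (Fin n) → ℝ} {c : ℝ}, 0 < c → Continuous w →
      (∀ x, c * (1 + ‖x‖ ^ 2) ≤ w x) →
      ∫⁻ z : Fin n → ℝ, ENNReal.ofReal (w (WithLp.toLp 2 z) ^ (n - 1))⁻¹ =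
        ENNReal.ofReal (∫ x, (w x ^ (n - 1))⁻¹) := fun {w c} hc hw hwl => by
    have h1 := hvol.lintegral_comp_emb hemb (fun x => ENNReal.ofReal (w x ^ (n - 1))⁻¹)
    rw [h1, ofReal_integral_eq_lintegral_ofReal
      (integrable_inv_pow_of_le volume (by simp; omega) hw hc hwl)]
    refine Filter.Eventually.of_forall fun x => ?_
    have : 0 < w x := lt_of_lt_of_le (by positivity) (hwl x)
    simp only [Pi.zero_apply]
    positivity
  rw [hlint hcu hu hul, hlint hcv hv hvl, hlint hcH hHc hHl] at h
  have hnn : ∀ {w : EuclideanSpace ℝ (Fin n) → ℝ} {c : ℝ}, 0 < c →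
      (∀ x, c * (1 + ‖x‖ ^ 2) ≤ w x) → 0 ≤ ∫ x, (w x ^ (n - 1))⁻¹ := fun {w c} hc hw =>
    integral_nonneg fun x => by
      have : 0 < w x := lt_of_lt_of_le (by positivity) (hw x)
      simp only [Pi.zero_apply]
      positivity
  have hu1 := hnn hcu hul
  have hv1 := hnn hcv hvl
  have ht1' : 0 ≤ 1 - t := by linarith
  rw [Nat.sub_self, pow_zero, pow_zero, mul_one, ENNReal.ofReal_one, one_mul,
    ← ENNReal.ofReal_mul ht1', ← ENNReal.ofReal_mul ht0.le,
    ← ENNReal.ofReal_add (by positivity) (by positivity)] at h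
  exact (ENNReal.ofReal_le_ofReal_iff (hnn hcH hHl)).1 h

theorem HasDerivAt.nonneg_of_eventually_nonneg {φ : ℝ → ℝ} {φ' : ℝ} (h : HasDerivAt φ φ' 0)
    (h0 : φ 0 = 0) (hp : ∀ᶠ t in nhdsWithin 0 (Set.Ioi 0), 0 ≤ φ t) : 0 ≤ φ' := by
  have h1 := (hasDerivWithinAt_iff_tendsto_slope' (by simp)).1
    (h.hasDerivWithinAt (s := Set.Ioi 0))
  refine ge_of_tendsto h1 ?_
  filter_upwards [hp, self_mem_nhdsWithin] with t ht ht0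
  rw [slope_def_field, h0, sub_zero, sub_zero]
  exact div_nonneg ht (le_of_lt ht0)

section

variable {E : Type*} [NormedAddCommGroup E] [NormedSpace ℝ E] [FiniteDimensional ℝ E]
  [MeasurableSpace E] [BorelSpace E]

theorem hasDerivAt_integral_inv_pow_add_mul (ν : Measure E) [ν.IsAddHaarMeasure] {m : ℕ}
    (hm : Module.finrank ℝ E < 2 * m) {G P : E → ℝ} (hG : Continuous G) (hP : Continuous P)
    {c C : ℝ} (hc : 0 < c) (hC : 0 ≤ C) (hGl : ∀ x, c * (1 + ‖x‖ ^ 2) ≤ G x)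
    (hPG : ∀ x, |P x| ≤ C * G x) :
    HasDerivAt (fun t : ℝ => ∫ x, ((G x + t * P x) ^ m)⁻¹ ∂ν)
      (∫ x, -(m : ℝ) * (P x * (G x ^ (m + 1))⁻¹) ∂ν) 0 := by
  have hG0 : ∀ x, 0 < G x := fun x => lt_of_lt_of_le (by positivity) (hGl x)
  set δ : ℝ := 1 / (2 * (C + 1)) with hδ
  have hδ0 : 0 < δ := by positivity
  have hlow : ∀ x, ∀ s ∈ Metric.ball (0 : ℝ) δ, G x / 2 ≤ G x + s * P x := fun x s hs => by
    rw [Metric.mem_ball, dist_zero_right, Real.norm_eq_abs] at hs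
    have h1 : |s * P x| ≤ δ * (C * G x) := by
      rw [abs_mul]
      exact mul_le_mul hs.le (hPG x) (abs_nonneg _) hδ0.le
    have h2 : δ * (C * G x) ≤ G x / 2 := by
      have := hG0 x
      rw [hδ, div_mul_eq_mul_div, div_le_div_iff₀ (by positivity) (by positivity)]
      nlinarith
    have := (abs_le.1 h1).1
    linarith
  have hpos : ∀ x, ∀ s ∈ Metric.ball (0 : ℝ) δ, 0 < G x + s * P x := fun x s hs =>
    lt_of_lt_of_le (half_pos (hG0 x)) (hlow x s hs)
  have key := hasDerivAt_integral_of_dominated_loc_of_deriv_le (μ := ν) (𝕜 := ℝ) (x₀ := (0 : ℝ))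
    (F := fun t x => ((G x + t * P x) ^ m)⁻¹)
    (F' := fun t x => -(m : ℝ) * (P x * ((G x + t * P x) ^ (m + 1))⁻¹))
    (bound := fun x => (m : ℝ) * C * 2 ^ (m + 1) * (G x ^ m)⁻¹)
    (Metric.ball_mem_nhds (0 : ℝ) hδ0) ?_ ?_ ?_ ?_ ?_ ?_
  · have h2 := key.2
    simpa using h2
  · filter_upwards [Metric.ball_mem_nhds (0 : ℝ) hδ0] with s hs
    exact (Continuous.inv₀ (by fun_prop)
      fun x => (pow_pos (hpos x s hs) m).ne').aestronglyMeasurable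
  · simpa using integrable_inv_pow_of_le ν hm hG hc hGl
  · simp only [zero_mul, add_zero]
    exact (continuous_const.mul (hP.mul (Continuous.inv₀ (by fun_prop)
      fun x => (pow_pos (hG0 x) _).ne'))).aestronglyMeasurable
  · refine Filter.Eventually.of_forall fun x s hs => ?_
    have h1 := hlow x s hs
    have h2 := hpos x s hs
    have h3 := hG0 x
    rw [norm_mul, norm_mul, norm_neg, Real.norm_natCast, Real.norm_eq_abs (P x),
      Real.norm_of_nonneg (by positivity)]
    calc (m : ℝ) * (|P x| * ((G x + s * P x) ^ (m + 1))⁻¹)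
        ≤ (m : ℝ) * (C * G x * ((G x / 2) ^ (m + 1))⁻¹) := by
          have := hPG x
          gcongr
      _ = _ := by
          rw [div_pow, pow_succ (G x)]
          field_simp
  · exact (integrable_inv_pow_of_le ν hm hG hc hGl).const_mul _
  · refine Filter.Eventually.of_forall fun x s hs => ?_
    have h2 := hpos x s hs
    have hd : HasDerivAt (fun t : ℝ => G x + t * P x) (P x) s := by
      simpa using ((hasDerivAt_id' s).mul_const (P x)).const_add (G x)
    have h3 := (hd.fun_pow m).fun_inv (pow_pos h2 m).ne'
    convert! h3 using 1
    rcases m with _ | m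
    · simp
    · rw [Nat.add_sub_cancel]
      generalize G x + s * P x = q at h2
      field_simp
      ring

end

theorem add_mul_sub_le_of_semiconvex {E : Type*} [NormedAddCommGroup E] [NormedSpace ℝ E]
    {G : E → ℝ} {L κ t : ℝ} (ht0 : 0 < t) (ht1 : t < 1) (hκ : 1 < κ)
    (ht : 1 < κ * (1 - L * (t / (1 - t)))) {x : E}
    (hconv : ∀ z, G z + fderiv ℝ G z (x - z) - L * ‖x - z‖ ^ 2 ≤ G x) (y : E) :
    G ((1 - t)⁻¹ • ((1 - t) • x + t • y)) + t * (1 - G ((1 - t)⁻¹ • ((1 - t) • x + t • y)) -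
      κ / 4 * ‖fderiv ℝ G ((1 - t)⁻¹ • ((1 - t) • x + t • y))‖ ^ 2) ≤
      (1 - t) * G x + t * (1 + ‖y‖ ^ 2) := by
  have ht1' : 0 < 1 - t := by linarith
  have hr : 0 < t / (1 - t) := by positivity
  set z := (1 - t)⁻¹ • ((1 - t) • x + t • y) with hz
  have hxz : x - z = -(t / (1 - t)) • y := by
    rw [hz, smul_add, smul_smul, smul_smul, inv_mul_cancel₀ ht1'.ne', one_smul, neg_smul,
      div_eq_inv_mul]
    abel
  have h1 := hconv z
  have h2 : |fderiv ℝ G z (x - z)| ≤ t / (1 - t) * (‖fderiv ℝ G z‖ * ‖y‖) := by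
    rw [hxz, map_smul, smul_eq_mul, abs_mul, abs_neg, abs_of_pos hr]
    have := (fderiv ℝ G z).le_opNorm y
    rw [Real.norm_eq_abs] at this
    gcongr
  have h3 : ‖x - z‖ ^ 2 = (t / (1 - t)) ^ 2 * ‖y‖ ^ 2 := by
    rw [hxz, norm_smul, norm_neg, Real.norm_of_nonneg hr.le, mul_pow]
  have h4 := (abs_le.1 h2).1
  rw [h3] at h1
  generalize ‖fderiv ℝ G z‖ = q at *
  generalize fderiv ℝ G z (x - z) = D at *
  generalize ‖y‖ = Y at *
  generalize G z = g at *
  generalize G x = h at *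
  have hrt : (1 - t) * (t / (1 - t)) = t := by field_simp
  generalize t / (1 - t) = r at *
  have hs : 0 < 1 - L * r := by
    by_contra hcon
    nlinarith
  have h6 : 0 ≤ (Y * (1 - L * r) - q / 2) ^ 2 + (κ * (1 - L * r) - 1) / 4 * q ^ 2 := by
    have : 0 ≤ κ * (1 - L * r) - 1 := by linarith
    positivity
  have h7 : 0 ≤ (1 - L * r) * (Y ^ 2 * (1 - L * r) - q * Y + κ / 4 * q ^ 2) := by
    refine h6.trans (le_of_eq ?_)
    ring
  have h5 := nonneg_of_mul_nonneg_right h7 hs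
  have h8 := mul_le_mul_of_nonneg_left h1 ht1'.le
  have h9 := mul_nonneg ht0.le h5
  have h10 := mul_le_mul_of_nonneg_left h4 ht1'.le
  have e4 : (1 - t) * -(r * (q * Y)) = -(t * (q * Y)) := by linear_combination -(q * Y) * hrt
  have e5 : (1 - t) * (L * (r ^ 2 * Y ^ 2)) = t * (L * r * Y ^ 2) := by
    linear_combination L * r * Y ^ 2 * hrt
  rw [e4] at h10
  rw [mul_sub, mul_add, e5] at h8
  linarith

/-- The infinitesimal form of the Borell–Brascamp–Lieb inequality, for a semiconvex function `G`
of quadratic growth, compared with `1 + ‖x‖ ^ 2`. -/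
theorem le_integral_inv_pow_mul_norm_fderiv_sq {n : ℕ} (hn : 3 ≤ n)
    {G : EuclideanSpace ℝ (Fin n) → ℝ} (hG : ContDiff ℝ 1 G) {c C L : ℝ} (hc : 0 < c)
    (hGl : ∀ x, c * (1 + ‖x‖ ^ 2) ≤ G x)
    (hDG : ∀ x, ‖fderiv ℝ G x‖ ^ 2 ≤ C * (1 + ‖x‖ ^ 2))
    (hconv : ∀ x z, G z + fderiv ℝ G z (x - z) - L * ‖x - z‖ ^ 2 ≤ G x)
    (hmass : ∫ x, (G x ^ n)⁻¹ = ∫ x : EuclideanSpace ℝ (Fin n), ((1 + ‖x‖ ^ 2) ^ n)⁻¹) :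
    (∫ x : EuclideanSpace ℝ (Fin n), ((1 + ‖x‖ ^ 2) ^ (n - 1))⁻¹) +
        (n - 1) * (∫ x : EuclideanSpace ℝ (Fin n), ((1 + ‖x‖ ^ 2) ^ n)⁻¹) ≤
      (n - 1) / 4 * ∫ x, (G x ^ n)⁻¹ * ‖fderiv ℝ G x‖ ^ 2 := by
  have hGc := hG.continuous
  have hDc : Continuous fun x => ‖fderiv ℝ G x‖ := (hG.continuous_fderiv one_ne_zero).norm
  have hG0 : ∀ x, 0 < G x := fun x => lt_of_lt_of_le (by positivity) (hGl x)
  have hC : 0 ≤ C := by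
    have := hDG 0
    simp only [norm_zero] at this
    nlinarith [sq_nonneg ‖fderiv ℝ G 0‖]
  have hn1 : n - 1 + 1 = n := by omega
  have hnc : ((n - 1 : ℕ) : ℝ) = (n : ℝ) - 1 := by rw [Nat.cast_sub (by omega)]; simp
  have hn3 : (3 : ℝ) ≤ n := by exact_mod_cast hn
  have hi0 := integrable_inv_pow_of_le volume (n := n) (by simp; omega) hGc hc hGl
  have hi1 := integrable_inv_pow_of_le volume (n := n - 1) (by simp; omega) hGc hc hGl
  have hDG' : ∀ x, ‖fderiv ℝ G x‖ ^ 2 ≤ C / c * G x := fun x =>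
    calc ‖fderiv ℝ G x‖ ^ 2 ≤ C * (1 + ‖x‖ ^ 2) := hDG x
      _ = C / c * (c * (1 + ‖x‖ ^ 2)) := by field_simp
      _ ≤ _ := by have := hGl x; gcongr
  have hi2 : Integrable fun x => (G x ^ n)⁻¹ * ‖fderiv ℝ G x‖ ^ 2 := by
    refine (hi1.const_mul (C / c)).mono' (Continuous.aestronglyMeasurable
      (Continuous.mul (Continuous.inv₀ (by fun_prop) fun x => (pow_pos (hG0 x) n).ne')
        (hDc.pow 2))) (Filter.Eventually.of_forall fun x => ?_)
    have h0 := hG0 x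
    rw [Real.norm_of_nonneg (by positivity)]
    calc (G x ^ n)⁻¹ * ‖fderiv ℝ G x‖ ^ 2 ≤ (G x ^ n)⁻¹ * (C / c * G x) := by
          have := hDG' x
          gcongr
      _ = _ := by
          rw [← hn1, pow_succ, Nat.add_sub_cancel]
          field_simp
  set X := ∫ x, (G x ^ n)⁻¹ * ‖fderiv ℝ G x‖ ^ 2 with hX
  set J := ∫ x : EuclideanSpace ℝ (Fin n), ((1 + ‖x‖ ^ 2) ^ (n - 1))⁻¹ with hJ
  set M := ∫ x : EuclideanSpace ℝ (Fin n), ((1 + ‖x‖ ^ 2) ^ n)⁻¹ with hM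
  have key : ∀ κ : ℝ, 1 < κ → J + (n - 1) * M ≤ κ * ((n - 1) / 4 * X) := by
    intro κ hκ
    set P : EuclideanSpace ℝ (Fin n) → ℝ := fun x => 1 - G x - κ / 4 * ‖fderiv ℝ G x‖ ^ 2 with hP
    have hPc : Continuous P := by fun_prop
    set C' : ℝ := 1 / c + 1 + κ / 4 * (C / c) with hC'
    have hC'0 : 0 < C' := by positivity
    have hPG : ∀ x, |P x| ≤ C' * G x := fun x => by
      have h1 : 1 ≤ 1 / c * G x := by
        have := hGl x
        rw [one_div, inv_mul_eq_div, le_div_iff₀ hc]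
        nlinarith [sq_nonneg ‖x‖]
      have h2 : κ / 4 * ‖fderiv ℝ G x‖ ^ 2 ≤ κ / 4 * (C / c * G x) := by
        have := hDG' x
        gcongr
      have h3 : 0 ≤ κ / 4 * ‖fderiv ℝ G x‖ ^ 2 := by positivity
      have h4 := hG0 x
      rw [abs_le]
      constructor <;> simp only [hP, hC'] <;> nlinarith
    have hd := hasDerivAt_integral_inv_pow_add_mul volume (m := n - 1) (by simp; omega)
      hGc hPc hc hC'0.le hGl hPG
    rw [hn1, hnc, integral_const_mul] at hd
    have hPint : ∫ x, P x * (G x ^ n)⁻¹ = M - (∫ x, (G x ^ (n - 1))⁻¹) - κ / 4 * X := by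
      have hi3 : Integrable fun x => (G x ^ n)⁻¹ - (G x ^ (n - 1))⁻¹ := hi0.sub hi1
      rw [← hmass, hX, ← integral_const_mul, ← integral_sub hi0 hi1,
        ← integral_sub hi3 (hi2.const_mul _)]
      refine integral_congr_ae (Filter.Eventually.of_forall fun x => ?_)
      have h4 := hG0 x
      have h5 : G x * (G x ^ n)⁻¹ = (G x ^ (n - 1))⁻¹ := by
        rw [← pow_sub_one_mul (by omega : n ≠ 0) (G x)]
        field_simp
      simp only [hP]
      rw [← h5]
      ring
    rw [hPint] at hd
    set Φ : ℝ → ℝ := fun t => ∫ x, ((G x + t * P x) ^ (n - 1))⁻¹ with hΦ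
    have hΦ0 : Φ 0 = ∫ x, (G x ^ (n - 1))⁻¹ := by simp [hΦ]
    rw [← hΦ0] at hd
    have hφ : HasDerivAt (fun t : ℝ => (1 - t) ^ n * Φ t - (1 - t) * Φ 0 - t * J)
        (-n * Φ 0 + (-(n - 1) * (M - Φ 0 - κ / 4 * X)) + Φ 0 - J) 0 := by
      have h1 : HasDerivAt (fun t : ℝ => 1 - t) (-1) 0 := by
        simpa using (hasDerivAt_id' (0 : ℝ)).const_sub 1
      have h2 := (((h1.fun_pow n).fun_mul hd).fun_sub (h1.mul_const (Φ 0))).fun_sub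
        ((hasDerivAt_id' (0 : ℝ)).mul_const J)
      convert! h2 using 1
      simp
    have hev : ∀ᶠ t in nhdsWithin (0 : ℝ) (Set.Ioi 0),
        0 ≤ (1 - t) ^ n * Φ t - (1 - t) * Φ 0 - t * J := by
      have e1 : ∀ᶠ t in nhdsWithin (0 : ℝ) (Set.Ioi 0), t < 1 :=
        nhdsWithin_le_nhds (gt_mem_nhds one_pos)
      have e2 : ∀ᶠ t in nhdsWithin (0 : ℝ) (Set.Ioi 0), t < 1 / (2 * C') :=
        nhdsWithin_le_nhds (gt_mem_nhds (by positivity))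
      have e3 : ∀ᶠ t in nhdsWithin (0 : ℝ) (Set.Ioi 0), 1 < κ * (1 - L * (t / (1 - t))) := by
        refine nhdsWithin_le_nhds (ContinuousAt.eventually_lt (f := fun _ => (1 : ℝ))
          continuousAt_const ?_ (by simpa using hκ))
        have : ContinuousAt (fun t : ℝ => t / (1 - t)) 0 :=
          ContinuousAt.div (by fun_prop) (by fun_prop) (by norm_num)
        fun_prop
      filter_upwards [e1, e2, e3, self_mem_nhdsWithin] with t ht1 ht2 ht3 ht0
      have ht0 : 0 < t := ht0
      have ht1' : 0 < 1 - t := by linarith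
      have hlow : ∀ x, G x / 2 ≤ G x + t * P x := fun x => by
        have h4 := hG0 x
        have h5 := (abs_le.1 (hPG x)).1
        have h6 : t * (C' * G x) ≤ G x / 2 := by
          have : t * C' ≤ 1 / 2 := by
            rw [lt_div_iff₀ (by positivity)] at ht2
            linarith
          nlinarith
        nlinarith
      have hscale : ∀ z : EuclideanSpace ℝ (Fin n), ‖z‖ ≤ ‖(1 - t)⁻¹ • z‖ := fun z => by
        rw [norm_smul, norm_inv, Real.norm_of_nonneg ht1'.le]
        exact le_mul_of_one_le_left (norm_nonneg z) ((one_le_inv₀ ht1').2 (by linarith))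
      have hbbl := borell_brascamp_lieb_euclideanSpace hn ht0 ht1 G (fun y => 1 + ‖y‖ ^ 2)
        (fun z => G ((1 - t)⁻¹ • z) + t * P ((1 - t)⁻¹ • z)) (cH := c / 2) hc one_pos
        (half_pos hc) hGc (by fun_prop) (by fun_prop) hGl (fun x => by rw [one_mul])
        (fun z => by
          refine le_trans ?_ (hlow _)
          have h1 := hGl ((1 - t)⁻¹ • z)
          have h2 : c * (1 + ‖z‖ ^ 2) ≤ c * (1 + ‖(1 - t)⁻¹ • z‖ ^ 2) := by
            have := hscale z
            gcongr
          linarith)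
        (fun x y => add_mul_sub_le_of_semiconvex ht0 ht1 hκ ht3 (hconv x) y)
        hmass
      have hcv := Measure.integral_comp_inv_smul_of_nonneg volume
        (fun x : EuclideanSpace ℝ (Fin n) => ((G x + t * P x) ^ (n - 1))⁻¹) ht1'.le
      rw [hcv, finrank_euclideanSpace_fin, smul_eq_mul, ← hΦ0] at hbbl
      change (1 - t) * Φ 0 + t * J ≤ (1 - t) ^ n * Φ t at hbbl
      linarith
    have := hφ.nonneg_of_eventually_nonneg (by simp) hev
    linarith
  have hlim : Filter.Tendsto (fun κ : ℝ => κ * ((n - 1) / 4 * X)) (nhdsWithin 1 (Set.Ioi 1))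
      (nhds (1 * ((n - 1) / 4 * X))) :=
    ((continuous_id.mul continuous_const).tendsto (1 : ℝ)).mono_left nhdsWithin_le_nhds
  rw [one_mul] at hlim
  exact ge_of_tendsto hlim (by filter_upwards [self_mem_nhdsWithin] with κ hκ using key κ hκ)

theorem pow_le_one_add_sq_pow {r : ℝ} (hr : 0 ≤ r) {j k : ℕ} (h : j ≤ 2 * k) :
    r ^ j ≤ (1 + r ^ 2) ^ k := by
  rcases le_total r 1 with h1 | h1
  · exact (pow_le_one₀ hr h1).trans (one_le_pow₀ (by nlinarith [sq_nonneg r]))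
  · calc r ^ j ≤ r ^ (2 * k) := pow_le_pow_right₀ h1 h
      _ = (r ^ 2) ^ k := pow_mul r 2 k
      _ ≤ _ := by gcongr; linarith

theorem integrableOn_pow_mul_inv_one_add_sq_pow {j k : ℕ} (h : j + 2 ≤ 2 * k) :
    IntegrableOn (fun r : ℝ => r ^ j * ((1 + r ^ 2) ^ k)⁻¹) (Set.Ioi 0) := by
  have h1 : ∀ r : ℝ, 0 < 1 + r ^ 2 := fun r => by positivity
  refine Integrable.mono' integrable_inv_one_add_sq.integrableOn
    (Continuous.aestronglyMeasurable ((continuous_id.pow j).mul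
      (Continuous.inv₀ (by fun_prop) fun r => (pow_pos (h1 r) k).ne'))) ?_
  filter_upwards [ae_restrict_mem measurableSet_Ioi] with r hr
  have hr : 0 < r := hr
  have h2 := h1 r
  obtain ⟨k, rfl⟩ : ∃ m, k = m + 1 := ⟨k - 1, by omega⟩
  have h3 := pow_le_one_add_sq_pow hr.le (show j ≤ 2 * k by omega)
  rw [Real.norm_of_nonneg (by positivity), pow_succ, mul_inv, ← mul_assoc]
  refine mul_le_of_le_one_left (by positivity) ?_
  rw [← div_eq_mul_inv, div_le_one (by positivity)]
  exact h3

theorem mul_integral_pow_mul_inv_one_add_sq_pow {p k : ℕ} (h : p + 3 ≤ 2 * k) (hp : 1 ≤ p) :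
    (p : ℝ) * (∫ r in Set.Ioi (0 : ℝ), r ^ (p - 1) * ((1 + r ^ 2) ^ k)⁻¹) =
      (2 * (k - 1) - p) * ∫ r in Set.Ioi (0 : ℝ), r ^ (p + 1) * ((1 + r ^ 2) ^ k)⁻¹ := by
  have h1 : ∀ r : ℝ, 0 < 1 + r ^ 2 := fun r => by positivity
  have i1 := integrableOn_pow_mul_inv_one_add_sq_pow (show p - 1 + 2 ≤ 2 * k by omega)
  have i2 := integrableOn_pow_mul_inv_one_add_sq_pow (show p + 1 + 2 ≤ 2 * k by omega)
  obtain ⟨k, rfl⟩ : ∃ m, k = m + 1 := ⟨k - 1, by omega⟩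
  obtain ⟨p, rfl⟩ : ∃ m, p = m + 1 := ⟨p - 1, by omega⟩
  rw [Nat.add_sub_cancel] at *
  have key := integral_Ioi_of_hasDerivAt_of_tendsto' (a := (0 : ℝ)) (m := 0)
    (f := fun r => r ^ (p + 1) * ((1 + r ^ 2) ^ k)⁻¹)
    (f' := fun r => ((p + 1 : ℕ) : ℝ) * (r ^ p * ((1 + r ^ 2) ^ (k + 1))⁻¹) -
      (2 * (((k + 1 : ℕ) : ℝ) - 1) - ((p + 1 : ℕ) : ℝ)) *
        (r ^ (p + 1 + 1) * ((1 + r ^ 2) ^ (k + 1))⁻¹)) ?_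
    ((i1.const_mul _).sub (i2.const_mul _)) ?_
  · rw [integral_sub (i1.const_mul _) (i2.const_mul _), integral_const_mul,
      integral_const_mul] at key
    simp only [ne_eq, Nat.add_eq_zero_iff, one_ne_zero, and_false, not_false_eq_true, zero_pow,
      zero_mul, sub_zero] at key
    linarith
  · intro r _
    have hd : HasDerivAt (fun r : ℝ => 1 + r ^ 2) (2 * r) r := by
      simpa using (hasDerivAt_pow 2 r).const_add 1
    have h3 := (hasDerivAt_pow (p + 1) r).fun_mul
      ((hd.fun_pow k).fun_inv (pow_pos (h1 r) k).ne')
    convert! h3 using 1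
    have h2 := h1 r
    rcases k with _ | k
    · omega
    · simp only [Nat.add_sub_cancel]
      push_cast
      generalize hq : 1 + r ^ 2 = q at h2
      have : r ^ 2 = q - 1 := by linarith
      field_simp
      ring_nf
      rw [this]
      ring
  · refine squeeze_zero' (g := fun r : ℝ => r⁻¹) ?_ ?_ tendsto_inv_atTop_zero
    · filter_upwards [Filter.eventually_gt_atTop 0] with r hr
      positivity
    · filter_upwards [Filter.eventually_gt_atTop 0] with r hr
      have h2 := h1 r
      have h3 := pow_le_one_add_sq_pow hr.le (show p + 2 ≤ 2 * k by omega)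
      rw [← div_eq_mul_inv, div_le_iff₀ (by positivity), inv_mul_eq_div, le_div_iff₀ hr]
      calc r ^ (p + 1) * r = r ^ (p + 2) := by ring
        _ ≤ _ := h3

theorem integrable_norm_sq_mul_inv_pow {d : ℕ} (hd : 3 ≤ d) :
    Integrable fun x : EuclideanSpace ℝ (Fin d) => ‖x‖ ^ 2 * ((1 + ‖x‖ ^ 2) ^ d)⁻¹ := by
  have : Nonempty (Fin d) := ⟨⟨0, by omega⟩⟩
  rw [integrable_fun_norm_addHaar volume (f := fun r : ℝ => r ^ 2 * ((1 + r ^ 2) ^ d)⁻¹)]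
  simp only [finrank_euclideanSpace_fin, smul_eq_mul, ← mul_assoc, ← pow_add]
  exact integrableOn_pow_mul_inv_one_add_sq_pow (by omega)

theorem integral_norm_sq_mul_inv_pow {d : ℕ} (hd : 3 ≤ d) :
    ∫ x : EuclideanSpace ℝ (Fin d), ‖x‖ ^ 2 * ((1 + ‖x‖ ^ 2) ^ d)⁻¹ =
      (d : ℝ) / (d - 2) * ∫ x : EuclideanSpace ℝ (Fin d), ((1 + ‖x‖ ^ 2) ^ d)⁻¹ := by
  have : Nonempty (Fin d) := ⟨⟨0, by omega⟩⟩
  have hd3 : (3 : ℝ) ≤ d := by exact_mod_cast hd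
  rw [integral_fun_norm_addHaar volume (fun r : ℝ => r ^ 2 * ((1 + r ^ 2) ^ d)⁻¹),
    integral_fun_norm_addHaar volume (fun r : ℝ => ((1 + r ^ 2) ^ d)⁻¹)]
  have h := mul_integral_pow_mul_inv_one_add_sq_pow (p := d) (k := d) (by omega) (by omega)
  simp only [finrank_euclideanSpace_fin, smul_eq_mul, ← mul_assoc, ← pow_add, nsmul_eq_mul]
  rw [show d - 1 + 2 = d + 1 by omega]
  have h2 : (d : ℝ) - 2 ≠ 0 := by linarith
  have h3 : ∫ r in Set.Ioi (0 : ℝ), r ^ (d + 1) * ((1 + r ^ 2) ^ d)⁻¹ =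
      d / (d - 2) * ∫ r in Set.Ioi (0 : ℝ), r ^ (d - 1) * ((1 + r ^ 2) ^ d)⁻¹ := by
    rw [div_mul_eq_mul_div, eq_div_iff h2]
    linear_combination -h
  rw [h3]
  ring

theorem integrable_inv_norm_sq_mul_inv_pow {d : ℕ} (hd : 3 ≤ d) :
    Integrable fun x : EuclideanSpace ℝ (Fin d) => (‖x‖ ^ 2)⁻¹ * ((1 + ‖x‖ ^ 2) ^ d)⁻¹ := by
  have : Nonempty (Fin d) := ⟨⟨0, by omega⟩⟩
  rw [integrable_fun_norm_addHaar volume (f := fun r : ℝ => (r ^ 2)⁻¹ * ((1 + r ^ 2) ^ d)⁻¹)]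
  refine (integrableOn_pow_mul_inv_one_add_sq_pow (show d - 3 + 2 ≤ 2 * d by omega)).congr_fun
    (fun r hr => ?_) measurableSet_Ioi
  have hr : 0 < r := hr
  simp only [finrank_euclideanSpace_fin, smul_eq_mul]
  rw [show d - 1 = d - 3 + 2 by omega, pow_add]
  field_simp

theorem integral_inv_norm_sq_mul_inv_pow {d : ℕ} (hd : 3 ≤ d) :
    ∫ x : EuclideanSpace ℝ (Fin d), (‖x‖ ^ 2)⁻¹ * ((1 + ‖x‖ ^ 2) ^ d)⁻¹ =
      (d : ℝ) / (d - 2) * ∫ x : EuclideanSpace ℝ (Fin d), ((1 + ‖x‖ ^ 2) ^ d)⁻¹ := by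
  have : Nonempty (Fin d) := ⟨⟨0, by omega⟩⟩
  have hd3 : (3 : ℝ) ≤ d := by exact_mod_cast hd
  rw [integral_fun_norm_addHaar volume (fun r : ℝ => (r ^ 2)⁻¹ * ((1 + r ^ 2) ^ d)⁻¹),
    integral_fun_norm_addHaar volume (fun r : ℝ => ((1 + r ^ 2) ^ d)⁻¹)]
  have h := mul_integral_pow_mul_inv_one_add_sq_pow (p := d - 2) (k := d) (by omega) (by omega)
  have h1 : ∫ r in Set.Ioi (0 : ℝ), r ^ (d - 1) • ((r ^ 2)⁻¹ * ((1 + r ^ 2) ^ d)⁻¹) =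
      ∫ r in Set.Ioi (0 : ℝ), r ^ (d - 2 - 1) * ((1 + r ^ 2) ^ d)⁻¹ :=
    setIntegral_congr_fun measurableSet_Ioi fun r hr => by
      have hr : 0 < r := hr
      rw [smul_eq_mul, show d - 1 = d - 2 - 1 + 2 by omega, pow_add]
      field_simp
  simp only [finrank_euclideanSpace_fin, smul_eq_mul, nsmul_eq_mul] at h1 ⊢
  rw [show d - 2 + 1 = d - 1 by omega, Nat.cast_sub (by omega)] at h
  rw [h1]
  push_cast at h
  have h2 : (d : ℝ) - 2 ≠ 0 := by linarith
  have h3 : ∫ r in Set.Ioi (0 : ℝ), r ^ (d - 2 - 1) * ((1 + r ^ 2) ^ d)⁻¹ =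
      d / (d - 2) * ∫ r in Set.Ioi (0 : ℝ), r ^ (d - 1) * ((1 + r ^ 2) ^ d)⁻¹ := by
    rw [div_mul_eq_mul_div, eq_div_iff h2]
    linear_combination h
  rw [h3]
  ring

theorem integral_inv_one_add_norm_sq_pow_pred {d : ℕ} (hd : 3 ≤ d) :
    ∫ x : EuclideanSpace ℝ (Fin d), ((1 + ‖x‖ ^ 2) ^ (d - 1))⁻¹ =
      2 * ((d : ℝ) - 1) / (d - 2) * ∫ x : EuclideanSpace ℝ (Fin d), ((1 + ‖x‖ ^ 2) ^ d)⁻¹ := by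
  have hd3 : (3 : ℝ) ≤ d := by exact_mod_cast hd
  have h2 : (d : ℝ) - 2 ≠ 0 := by linarith
  have h1 : ∀ x : EuclideanSpace ℝ (Fin d), ((1 + ‖x‖ ^ 2) ^ (d - 1))⁻¹ =
      ((1 + ‖x‖ ^ 2) ^ d)⁻¹ + ‖x‖ ^ 2 * ((1 + ‖x‖ ^ 2) ^ d)⁻¹ := fun x => by
    have : 0 < 1 + ‖x‖ ^ 2 := by positivity
    rw [← pow_sub_one_mul (by omega : d ≠ 0) (1 + ‖x‖ ^ 2)]
    field_simp
  simp_rw [h1]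
  rw [integral_add (integrable_inv_one_add_norm_sq_pow volume (by simp; omega))
    (integrable_norm_sq_mul_inv_pow hd), integral_norm_sq_mul_inv_pow hd]
  field_simp
  ring

theorem integral_inv_one_add_norm_sq_pow_pos {d : ℕ} (hd : 3 ≤ d) :
    0 < ∫ x : EuclideanSpace ℝ (Fin d), ((1 + ‖x‖ ^ 2) ^ d)⁻¹ := by
  have hc : Continuous fun x : EuclideanSpace ℝ (Fin d) => ((1 + ‖x‖ ^ 2) ^ d)⁻¹ :=
    Continuous.inv₀ (by fun_prop) fun x => by positivity
  refine integral_pos_of_integrable_nonneg_nonzero (x := 0) hc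
    (integrable_inv_one_add_norm_sq_pow volume (by simp; omega)) (fun x => ?_) (by simp)
  simp only [Pi.zero_apply]
  positivity

/-- The scale-invariant form of `le_integral_inv_pow_mul_norm_fderiv_sq`. -/
theorem mul_rpow_le_integral_inv_pow_mul_norm_fderiv_sq {n : ℕ} (hn : 3 ≤ n)
    {G : EuclideanSpace ℝ (Fin n) → ℝ} (hG : ContDiff ℝ 1 G) {c C L : ℝ} (hc : 0 < c)
    (hGl : ∀ x, c * (1 + ‖x‖ ^ 2) ≤ G x)
    (hDG : ∀ x, ‖fderiv ℝ G x‖ ^ 2 ≤ C * (1 + ‖x‖ ^ 2))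
    (hconv : ∀ x z, G z + fderiv ℝ G z (x - z) - L * ‖x - z‖ ^ 2 ≤ G x) :
    4 * n / (n - 2) * (∫ x : EuclideanSpace ℝ (Fin n), ((1 + ‖x‖ ^ 2) ^ n)⁻¹) *
        ((∫ x, (G x ^ n)⁻¹) / ∫ x : EuclideanSpace ℝ (Fin n), ((1 + ‖x‖ ^ 2) ^ n)⁻¹) ^
          (((n : ℝ) - 2) / n) ≤
      ∫ x, (G x ^ n)⁻¹ * ‖fderiv ℝ G x‖ ^ 2 := by
  have hn3 : (3 : ℝ) ≤ n := by exact_mod_cast hn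
  have hG0 : ∀ x, 0 < G x := fun x => lt_of_lt_of_le (by positivity) (hGl x)
  have hM0 := integral_inv_one_add_norm_sq_pow_pos hn
  have hJ := integral_inv_one_add_norm_sq_pow_pred hn
  set M := ∫ x : EuclideanSpace ℝ (Fin n), ((1 + ‖x‖ ^ 2) ^ n)⁻¹ with hM
  have hm0 : 0 < ∫ x, (G x ^ n)⁻¹ := by
    refine integral_pos_of_integrable_nonneg_nonzero (x := 0)
      (Continuous.inv₀ (hG.continuous.pow n) fun x => (pow_pos (hG0 x) n).ne')
      (integrable_inv_pow_of_le volume (by simp; omega) hG.continuous hc hGl) (fun x => ?_)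
      (inv_pos.2 (pow_pos (hG0 0) n)).ne'
    have := hG0 x
    simp only [Pi.zero_apply]
    positivity
  set m := ∫ x, (G x ^ n)⁻¹ with hm
  set s : ℝ := (m / M) ^ (1 / (n : ℝ)) with hs
  have hs0 : 0 < s := by positivity
  have hsn : s ^ n = m / M := by
    rw [hs, ← Real.rpow_natCast, ← Real.rpow_mul (by positivity), one_div_mul_cancel (by positivity),
      Real.rpow_one]
  have hD : ∀ x, fderiv ℝ (fun x => s * G x) x = s • fderiv ℝ G x := fun x =>
    fderiv_const_mul (hG.differentiable one_ne_zero x) s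
  have key := le_integral_inv_pow_mul_norm_fderiv_sq hn (G := fun x => s * G x)
    (contDiff_const.mul hG) (c := s * c) (C := s ^ 2 * C) (L := s * L) (by positivity)
    (fun x => by
      have := mul_le_mul_of_nonneg_left (hGl x) hs0.le
      linarith)
    (fun x => by
      rw [hD, norm_smul, mul_pow, Real.norm_of_nonneg hs0.le, mul_assoc]
      have := hDG x
      gcongr)
    (fun x z => by
      rw [hD]
      have := mul_le_mul_of_nonneg_left (hconv x z) hs0.le
      simp only [smul_apply, smul_eq_mul]
      linarith)
    (by
      simp only [mul_pow, mul_inv]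
      rw [integral_const_mul, ← hM, ← hm, hsn]
      field_simp)
  have hX : ∫ x, ((s * G x) ^ n)⁻¹ * ‖fderiv ℝ (fun x => s * G x) x‖ ^ 2 =
      ((s ^ n)⁻¹ * s ^ 2) * ∫ x, (G x ^ n)⁻¹ * ‖fderiv ℝ G x‖ ^ 2 := by
    rw [← integral_const_mul]
    congr 1 with x
    rw [hD, norm_smul, mul_pow, mul_pow, mul_inv, Real.norm_of_nonneg hs0.le]
    ring
  rw [hX, hJ, ← hM] at key
  set X := ∫ x, (G x ^ n)⁻¹ * ‖fderiv ℝ G x‖ ^ 2 with hXdef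
  have hexp : (m / M) ^ (((n : ℝ) - 2) / n) = s ^ n * (s ^ 2)⁻¹ := by
    rw [hs, ← Real.rpow_natCast, ← Real.rpow_natCast, ← Real.rpow_mul (by positivity),
      ← Real.rpow_mul (by positivity), ← Real.rpow_neg (by positivity),
      ← Real.rpow_add (by positivity)]
    congr 1
    push_cast
    field_simp
    ring
  rw [hexp]
  have h2 : 0 < (n : ℝ) - 2 := by linarith
  have h1 : 0 < (n : ℝ) - 1 := by linarith
  have e1 : 2 * ((n : ℝ) - 1) / (n - 2) * M + (n - 1) * M = (n - 1) / 4 * (4 * n / (n - 2) * M) := by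
    field_simp
    ring
  rw [e1] at key
  have key2 := le_of_mul_le_mul_left key (by positivity)
  calc 4 * n / (n - 2) * M * (s ^ n * (s ^ 2)⁻¹)
      ≤ (s ^ n)⁻¹ * s ^ 2 * X * (s ^ n * (s ^ 2)⁻¹) := by gcongr
    _ = X := by field_simp

theorem exists_norm_sub_fderiv_le_mul_sq {E : Type*} [NormedAddCommGroup E]
    [NormedSpace ℝ E] {φ : E → ℝ} (hφ : ContDiff ℝ 2 φ) (hs : HasCompactSupport φ) :
    ∃ L : ℝ, ∀ x z, ‖φ x - φ z - fderiv ℝ φ z (x - z)‖ ≤ L * ‖x - z‖ ^ 2 := by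
  obtain ⟨L, hL⟩ := ContDiff.lipschitzWith_of_hasCompactSupport (hs.fderiv (𝕜 := ℝ))
    (hφ.fderiv_right (m := 1) (by norm_num)) one_ne_zero
  refine ⟨L, fun x z => ?_⟩
  have h := (convex_closedBall z ‖x - z‖).norm_image_sub_le_of_norm_hasFDerivWithin_le'
    (f := φ) (f' := fun y => fderiv ℝ φ y) (φ := fderiv ℝ φ z) (C := L * ‖x - z‖)
    (fun y _ => (hφ.differentiable (by norm_num) y).hasFDerivAt.hasFDerivWithinAt)
    (fun y hy => by
      refine (hL.norm_sub_le y z).trans ?_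
      rw [mem_closedBall_iff_norm] at hy
      gcongr)
    (Metric.mem_closedBall_self (norm_nonneg _))
    (by rw [mem_closedBall_iff_norm] : x ∈ Metric.closedBall z ‖x - z‖)
  calc _ ≤ _ := h
    _ = _ := by ring

theorem mul_rpow_le_of_add_hasCompactSupport {n : ℕ} (hn : 3 ≤ n)
    {φ : EuclideanSpace ℝ (Fin n) → ℝ} (hφ : ContDiff ℝ 2 φ) (hs : HasCompactSupport φ)
    {κ c : ℝ} (hκ : 0 < κ) (hc : 0 < c) {G : EuclideanSpace ℝ (Fin n) → ℝ}
    (hG : ∀ x, G x = κ * (1 + ‖x‖ ^ 2) + φ x) (hGl : ∀ x, c * (1 + ‖x‖ ^ 2) ≤ G x) :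
    4 * n / (n - 2) * (∫ x : EuclideanSpace ℝ (Fin n), ((1 + ‖x‖ ^ 2) ^ n)⁻¹) *
        ((∫ x, (G x ^ n)⁻¹) / ∫ x : EuclideanSpace ℝ (Fin n), ((1 + ‖x‖ ^ 2) ^ n)⁻¹) ^
          (((n : ℝ) - 2) / n) ≤
      ∫ x, (G x ^ n)⁻¹ * ‖fderiv ℝ G x‖ ^ 2 := by
  obtain rfl : G = fun x => κ * (1 + ‖x‖ ^ 2) + φ x := funext hG
  obtain ⟨L, hL⟩ := exists_norm_sub_fderiv_le_mul_sq hφ hs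
  obtain ⟨B, hB⟩ := (hφ.continuous_fderiv (by norm_num)).bounded_above_of_compact_support
    (hs.fderiv (𝕜 := ℝ))
  have hD : ∀ x, HasFDerivAt (fun x => κ * (1 + ‖x‖ ^ 2) + φ x)
      (κ • (2 • innerSL ℝ x) + fderiv ℝ φ x) x := fun x =>
    (((hasStrictFDerivAt_norm_sq x).hasFDerivAt.const_add 1).const_mul κ).add
      (hφ.differentiable (by norm_num) x).hasFDerivAt
  refine mul_rpow_le_integral_inv_pow_mul_norm_fderiv_sq hn (L := L)
    (C := 8 * κ ^ 2 + 2 * B ^ 2) ?_ hc hGl (fun x => ?_) (fun x z => ?_)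
  · exact ((contDiff_const.mul (contDiff_const.add (contDiff_norm_sq ℝ))).add hφ).of_le (by norm_num)
  · rw [(hD x).fderiv]
    have h1 : ‖κ • (2 • innerSL ℝ x) + fderiv ℝ φ x‖ ≤ 2 * κ * ‖x‖ + B := by
      refine (norm_add_le _ _).trans (add_le_add ?_ (hB x))
      rw [norm_smul, Real.norm_of_nonneg hκ.le, ← Nat.cast_smul_eq_nsmul ℝ, norm_smul,
        innerSL_apply_norm]
      simp
      linarith
    have h2 := pow_le_pow_left₀ (norm_nonneg _) h1 2
    have h3 := sq_nonneg (2 * κ * ‖x‖ - B)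
    nlinarith [mul_nonneg (sq_nonneg B) (sq_nonneg ‖x‖), sq_nonneg κ]
  · rw [(hD z).fderiv]
    have h1 := (abs_le.1 ((Real.norm_eq_abs _).symm.trans_le (hL x z))).1
    have h2 : ‖x‖ ^ 2 = ‖z‖ ^ 2 + 2 * inner ℝ z (x - z) + ‖x - z‖ ^ 2 := by
      rw [← norm_add_sq_real, add_sub_cancel]
    simp only [add_apply, smul_apply, smul_eq_mul,
      innerSL_apply_apply, nsmul_eq_mul, Nat.cast_ofNat]
    have h3 : 0 ≤ κ * ‖x - z‖ ^ 2 := by positivity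
    rw [h2]
    nlinarith

theorem sum_sq_apply_single {n : ℕ} (L : EuclideanSpace ℝ (Fin n) →L[ℝ] ℝ) :
    ∑ i, L (EuclideanSpace.single i 1) ^ 2 = ‖L‖ ^ 2 := by
  have h := (EuclideanSpace.basisFun (Fin n) ℝ).norm_dual L
  rw [h, Finset.sum_congr rfl]
  intro i _
  simp

theorem sum_norm_sq_apply_single {n : ℕ} (L : EuclideanSpace ℝ (Fin n) →L[ℝ] ℂ) :
    ∑ i, ‖L (EuclideanSpace.single i 1)‖ ^ 2 =
      ‖Complex.reCLM.comp L‖ ^ 2 + ‖Complex.imCLM.comp L‖ ^ 2 := by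
  rw [← sum_sq_apply_single, ← sum_sq_apply_single, ← Finset.sum_add_distrib]
  refine Finset.sum_congr rfl fun i _ => ?_
  rw [← Complex.normSq_eq_norm_sq, Complex.normSq_apply]
  simp only [ContinuousLinearMap.comp_apply, Complex.reCLM_apply, Complex.imCLM_apply]
  ring

theorem inv_pow_mul_norm_fderiv_rpow_sq_le {E : Type*} [NormedAddCommGroup E] [NormedSpace ℝ E]
    {n : ℕ} (hn : 3 ≤ n) {u v w : E → ℝ} {x : E} (hu : DifferentiableAt ℝ u x)
    (hv : DifferentiableAt ℝ v x) (hw : DifferentiableAt ℝ w x)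
    (hF : 0 < u x ^ 2 + v x ^ 2 + w x ^ 2) :
    (((u x ^ 2 + v x ^ 2 + w x ^ 2) ^ (-(1 / ((n : ℝ) - 2)))) ^ n)⁻¹ *
      ‖fderiv ℝ (fun x => (u x ^ 2 + v x ^ 2 + w x ^ 2) ^ (-(1 / ((n : ℝ) - 2)))) x‖ ^ 2 ≤
      4 / ((n : ℝ) - 2) ^ 2 *
        (‖fderiv ℝ u x‖ ^ 2 + ‖fderiv ℝ v x‖ ^ 2 + ‖fderiv ℝ w x‖ ^ 2) := by
  have hn3 : (3 : ℝ) ≤ n := by exact_mod_cast hn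
  have h2 : 0 < (n : ℝ) - 2 := by linarith
  set p : ℝ := 1 / ((n : ℝ) - 2) with hp
  have hd : HasFDerivAt (fun x => u x ^ 2 + v x ^ 2 + w x ^ 2)
      ((2 : ℝ) • (u x • fderiv ℝ u x + v x • fderiv ℝ v x + w x • fderiv ℝ w x)) x := by
    have := ((HasFDerivAt.pow hu.hasFDerivAt 2).fun_add
      (HasFDerivAt.pow hv.hasFDerivAt 2)).fun_add (HasFDerivAt.pow hw.hasFDerivAt 2)
    convert! this using 1
    simp only [Nat.add_one_sub_one, pow_one, smul_add, smul_smul]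
    simp
  have hd2 := hd.rpow_const (p := -p) (Or.inl hF.ne')
  rw [hd2.fderiv]
  set F := u x ^ 2 + v x ^ 2 + w x ^ 2 with hFdef
  have h3 : ‖u x • fderiv ℝ u x + v x • fderiv ℝ v x + w x • fderiv ℝ w x‖ ^ 2 ≤
      F * (‖fderiv ℝ u x‖ ^ 2 + ‖fderiv ℝ v x‖ ^ 2 + ‖fderiv ℝ w x‖ ^ 2) := by
    have h4 : ‖u x • fderiv ℝ u x + v x • fderiv ℝ v x + w x • fderiv ℝ w x‖ ≤
        |u x| * ‖fderiv ℝ u x‖ + |v x| * ‖fderiv ℝ v x‖ + |w x| * ‖fderiv ℝ w x‖ := by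
      refine (norm_add₃_le).trans_eq ?_
      simp only [norm_smul, Real.norm_eq_abs]
    refine (pow_le_pow_left₀ (norm_nonneg _) h4 2).trans ?_
    rw [hFdef, ← sq_abs (u x), ← sq_abs (v x), ← sq_abs (w x)]
    generalize |u x| = a, |v x| = b, |w x| = c, ‖fderiv ℝ u x‖ = a', ‖fderiv ℝ v x‖ = b',
      ‖fderiv ℝ w x‖ = c'
    nlinarith [sq_nonneg (a * b' - b * a'), sq_nonneg (a * c' - c * a'),
      sq_nonneg (b * c' - c * b')]
  rw [norm_smul, norm_smul, Real.norm_ofNat, norm_mul, norm_neg,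
    Real.norm_of_nonneg (by positivity : 0 ≤ p),
    Real.norm_of_nonneg (by positivity : 0 ≤ F ^ (-p - 1)), mul_pow, mul_pow, mul_pow]
  have h5 : ((F ^ (-p)) ^ n)⁻¹ * (F ^ (-p - 1)) ^ 2 = F⁻¹ := by
    rw [← Real.rpow_natCast, ← Real.rpow_natCast, ← Real.rpow_mul hF.le, ← Real.rpow_mul hF.le,
      ← Real.rpow_neg hF.le, ← Real.rpow_add hF, ← Real.rpow_neg_one]
    congr 1
    rw [hp]
    push_cast
    field_simp
    ring
  calc _ = 4 * p ^ 2 * (((F ^ (-p)) ^ n)⁻¹ * (F ^ (-p - 1)) ^ 2) *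
        ‖u x • fderiv ℝ u x + v x • fderiv ℝ v x + w x • fderiv ℝ w x‖ ^ 2 := by ring
    _ ≤ 4 * p ^ 2 * F⁻¹ *
        (F * (‖fderiv ℝ u x‖ ^ 2 + ‖fderiv ℝ v x‖ ^ 2 + ‖fderiv ℝ w x‖ ^ 2)) := by
          rw [h5]
          gcongr
    _ = _ := by
          rw [hp]
          field_simp

theorem hasFDerivAt_one_add_norm_sq_rpow {E : Type*} [NormedAddCommGroup E]
    [InnerProductSpace ℝ E] (p : ℝ) (x : E) :
    HasFDerivAt (fun x : E => (1 + ‖x‖ ^ 2) ^ p)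
      ((p * (1 + ‖x‖ ^ 2) ^ (p - 1)) • (2 • innerSL ℝ x)) x :=
  ((hasStrictFDerivAt_norm_sq x).hasFDerivAt.const_add 1).rpow_const
    (Or.inl (by positivity))

theorem norm_fderiv_one_add_norm_sq_rpow_sq {E : Type*} [NormedAddCommGroup E]
    [InnerProductSpace ℝ E] (n : ℕ) (s : ℝ) (x : E) :
    ‖fderiv ℝ (fun x : E => s * (1 + ‖x‖ ^ 2) ^ (-(((n : ℝ) - 2) / 2))) x‖ ^ 2 =
      s ^ 2 * (((n : ℝ) - 2) ^ 2 * (‖x‖ ^ 2 * ((1 + ‖x‖ ^ 2) ^ n)⁻¹)) := by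
  rw [((hasFDerivAt_one_add_norm_sq_rpow _ x).const_mul s).fderiv, norm_smul, norm_smul,
    ← Nat.cast_smul_eq_nsmul ℝ, norm_smul, innerSL_apply_norm, mul_pow, mul_pow, mul_pow,
    norm_mul, mul_pow, Real.norm_eq_abs, sq_abs, Real.norm_eq_abs, sq_abs, Real.norm_eq_abs,
    sq_abs, Real.norm_eq_abs, sq_abs]
  have h : 0 < 1 + ‖x‖ ^ 2 := by positivity
  have h5 : ((1 + ‖x‖ ^ 2) ^ (-(((n : ℝ) - 2) / 2) - 1)) ^ 2 = ((1 + ‖x‖ ^ 2) ^ n)⁻¹ := by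
    generalize 1 + ‖x‖ ^ 2 = q at h
    rw [← Real.rpow_natCast, ← Real.rpow_natCast, ← Real.rpow_mul h.le, ← Real.rpow_neg h.le]
    congr 1
    push_cast
    ring
  rw [h5]
  push_cast
  ring

/-- The sharp Sobolev inequality for compactly supported functions. -/
theorem sharp_sobolev_of_hasCompactSupport {n : ℕ} (hn : 3 ≤ n)
    {g : EuclideanSpace ℝ (Fin n) → ℂ} (hg : ContDiff ℝ 2 g) (hs : HasCompactSupport g) :
    n * (n - 2) * (∫ x : EuclideanSpace ℝ (Fin n), ((1 + ‖x‖ ^ 2) ^ n)⁻¹) *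
        ((∫ x, ‖g x‖ ^ (2 * (n : ℝ) / (n - 2))) /
          ∫ x : EuclideanSpace ℝ (Fin n), ((1 + ‖x‖ ^ 2) ^ n)⁻¹) ^ (((n : ℝ) - 2) / n) ≤
      ∫ x, ∑ i, ‖fderiv ℝ g x (EuclideanSpace.single i 1)‖ ^ 2 := by
  have hn3 : (3 : ℝ) ≤ n := by exact_mod_cast hn
  have h2 : 0 < (n : ℝ) - 2 := by linarith
  have hM0 := integral_inv_one_add_norm_sq_pow_pos hn
  set M := ∫ x : EuclideanSpace ℝ (Fin n), ((1 + ‖x‖ ^ 2) ^ n)⁻¹ with hM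
  set p : ℝ := 1 / ((n : ℝ) - 2) with hp
  have hgd := hg.differentiable (by norm_num)
  have hint1 : Integrable fun x => ∑ i, ‖fderiv ℝ g x (EuclideanSpace.single i 1)‖ ^ 2 := by
    refine Continuous.integrable_of_hasCompactSupport ?_ ?_
    · have := hg.continuous_fderiv (by norm_num)
      fun_prop
    · refine (hs.fderiv (𝕜 := ℝ)).mono ?_
      intro x hx hx0
      simp [hx0] at hx
  have hint2 := integrable_norm_sq_mul_inv_pow hn
  set D := ∫ x, ∑ i, ‖fderiv ℝ g x (EuclideanSpace.single i 1)‖ ^ 2 with hD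
  set I := ∫ x : EuclideanSpace ℝ (Fin n), ‖x‖ ^ 2 * ((1 + ‖x‖ ^ 2) ^ n)⁻¹ with hI
  have hI0 : 0 ≤ I := integral_nonneg fun x => by
    simp only [Pi.zero_apply]
    positivity
  have key : ∀ e : ℝ, 0 < e → n * (n - 2) * M *
      ((∫ x, ‖g x‖ ^ (2 * (n : ℝ) / (n - 2))) / M) ^ (((n : ℝ) - 2) / n) ≤
      D + e * ((n - 2) ^ 2 * I) := by
    intro e he
    set u : EuclideanSpace ℝ (Fin n) → ℝ := fun x => (g x).re with hu
    set v : EuclideanSpace ℝ (Fin n) → ℝ := fun x => (g x).im with hv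
    set w : EuclideanSpace ℝ (Fin n) → ℝ :=
      fun x => Real.sqrt e * (1 + ‖x‖ ^ 2) ^ (-(((n : ℝ) - 2) / 2)) with hw
    have hw2 : ∀ x, w x ^ 2 = e * ((1 + ‖x‖ ^ 2) ^ (n - 2))⁻¹ := fun x => by
      have h : 0 < 1 + ‖x‖ ^ 2 := by positivity
      rw [hw, mul_pow, Real.sq_sqrt he.le]
      generalize 1 + ‖x‖ ^ 2 = q at h
      rw [← Real.rpow_natCast, ← Real.rpow_natCast,
        ← Real.rpow_mul h.le, ← Real.rpow_neg h.le, Nat.cast_sub (by omega)]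
      congr 2
      push_cast
      ring
    have huv : ∀ x, u x ^ 2 + v x ^ 2 = ‖g x‖ ^ 2 := fun x => by
      rw [← Complex.normSq_eq_norm_sq, Complex.normSq_apply]
      ring
    set ψ : EuclideanSpace ℝ (Fin n) → ℝ :=
      fun x => (u x ^ 2 + v x ^ 2) * (1 + ‖x‖ ^ 2) ^ (n - 2) with hψ
    have huc : ContDiff ℝ 2 u := Complex.reCLM.contDiff.comp hg
    have hvc : ContDiff ℝ 2 v := Complex.imCLM.contDiff.comp hg
    have hqc : ContDiff ℝ 2 fun x : EuclideanSpace ℝ (Fin n) => 1 + ‖x‖ ^ 2 :=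
      contDiff_const.add (contDiff_norm_sq ℝ)
    have hψc : ContDiff ℝ 2 ψ := ((huc.pow 2).add (hvc.pow 2)).mul (hqc.pow _)
    have hψ0 : ∀ x, 0 ≤ ψ x := fun x => by positivity
    have hψs : HasCompactSupport ψ := by
      refine hs.mono fun x hx hx0 => hx ?_
      simp [hψ, hu, hv, hx0]
    obtain ⟨B, hB⟩ := hψc.continuous.bounded_above_of_compact_support hψs
    have hB0 : 0 ≤ B := (norm_nonneg _).trans (hB 0)
    have hF : ∀ x, u x ^ 2 + v x ^ 2 + w x ^ 2 = (e + ψ x) * ((1 + ‖x‖ ^ 2) ^ (n - 2))⁻¹ :=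
      fun x => by
        have h : 0 < 1 + ‖x‖ ^ 2 := by positivity
        rw [hw2, hψ]
        field_simp
        ring
    have hF0 : ∀ x, 0 < u x ^ 2 + v x ^ 2 + w x ^ 2 := fun x => by
      have := hψ0 x
      rw [hF]
      positivity
    set G : EuclideanSpace ℝ (Fin n) → ℝ :=
      fun x => (u x ^ 2 + v x ^ 2 + w x ^ 2) ^ (-p) with hG
    have hGe : ∀ x, G x = (1 + ‖x‖ ^ 2) * (e + ψ x) ^ (-p) := fun x => by
      have h : 0 < 1 + ‖x‖ ^ 2 := by positivity
      have := hψ0 x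
      rw [hG]
      simp only
      rw [hF, Real.mul_rpow (by positivity) (by positivity), Real.rpow_neg (inv_nonneg.2 (by positivity)),
        Real.inv_rpow (by positivity), inv_inv, ← Real.rpow_natCast, ← Real.rpow_mul h.le,
        Nat.cast_sub (by omega), hp, mul_one_div, Nat.cast_ofNat, div_self h2.ne', Real.rpow_one,
        mul_comm]
    have hp0 : 0 < p := by positivity
    have hGl : ∀ x, (e + B) ^ (-p) * (1 + ‖x‖ ^ 2) ≤ G x := fun x => by
      have h3 := hψ0 x
      have h4 : ψ x ≤ B := (le_abs_self _).trans (hB x)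
      rw [hGe, mul_comm]
      exact mul_le_mul_of_nonneg_left
        (Real.rpow_le_rpow_of_nonpos (by positivity) (by linarith) (by linarith)) (by positivity)
    have h1 := mul_rpow_le_of_add_hasCompactSupport hn
      (φ := fun x => (1 + ‖x‖ ^ 2) * ((e + ψ x) ^ (-p) - e ^ (-p))) (G := G) (κ := e ^ (-p))
      (c := (e + B) ^ (-p))
      (hqc.mul (((contDiff_const.add hψc).rpow_const_of_ne
        fun x => (add_pos_of_pos_of_nonneg he (hψ0 x)).ne').sub contDiff_const))
      (hψs.mono fun x hx hx0 => hx (by simp [hx0])) (by positivity) (by positivity)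
      (fun x => by rw [hGe]; ring)
      hGl
    have hGc : Continuous G := by
      have h3 : Continuous fun x => (e + ψ x) ^ (-p) :=
        (continuous_const.add hψc.continuous).rpow_const
          fun x => Or.inl (add_pos_of_pos_of_nonneg he (hψ0 x)).ne'
      exact (hqc.continuous.mul h3).congr fun x => (hGe x).symm
    have hGint : Integrable fun x => (G x ^ n)⁻¹ :=
      integrable_inv_pow_of_le volume (by simp; omega) hGc (by positivity) hGl
    have hmass : ∫ x, ‖g x‖ ^ (2 * (n : ℝ) / (n - 2)) ≤ ∫ x, (G x ^ n)⁻¹ := by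
      refine integral_mono_of_nonneg (Filter.Eventually.of_forall fun x => by positivity) hGint
        (Filter.Eventually.of_forall fun x => ?_)
      have h3 : (G x ^ n)⁻¹ = (u x ^ 2 + v x ^ 2 + w x ^ 2) ^ ((n : ℝ) / (n - 2)) := by
        rw [hG, ← Real.rpow_natCast, ← Real.rpow_mul (hF0 x).le, ← Real.rpow_neg (hF0 x).le, hp]
        congr 1
        ring
      have h4 : ‖g x‖ ^ (2 * (n : ℝ) / (n - 2)) = (‖g x‖ ^ 2) ^ ((n : ℝ) / (n - 2)) := by
        rw [← Real.rpow_natCast, ← Real.rpow_mul (norm_nonneg _)]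
        congr 1
        push_cast
        ring
      simp only [h3, h4]
      refine Real.rpow_le_rpow (by positivity) ?_ (by positivity)
      rw [huv]
      exact le_add_of_nonneg_right (sq_nonneg _)
    have hgrad : ∫ x, (G x ^ n)⁻¹ * ‖fderiv ℝ G x‖ ^ 2 ≤
        4 / ((n : ℝ) - 2) ^ 2 * (D + e * ((n - 2) ^ 2 * I)) := by
      have hr : D + e * ((n - 2) ^ 2 * I) = ∫ x, ((∑ i, ‖fderiv ℝ g x (EuclideanSpace.single i 1)‖ ^ 2) +
          e * (((n : ℝ) - 2) ^ 2 * (‖x‖ ^ 2 * ((1 + ‖x‖ ^ 2) ^ n)⁻¹))) := by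
        rw [integral_add hint1 ((hint2.const_mul _).const_mul _), integral_const_mul,
          integral_const_mul]
      rw [hr, ← integral_const_mul]
      refine integral_mono_of_nonneg (Filter.Eventually.of_forall fun x => ?_)
        ((hint1.add ((hint2.const_mul _).const_mul _)).const_mul _)
        (Filter.Eventually.of_forall fun x => ?_)
      · have : 0 < G x := Real.rpow_pos_of_pos (hF0 x) _
        simp only [Pi.zero_apply]
        positivity
      · have h3 := inv_pow_mul_norm_fderiv_rpow_sq_le hn
          (huc.differentiable (by norm_num) x) (hvc.differentiable (by norm_num) x)
          ((hasFDerivAt_one_add_norm_sq_rpow _ x).const_mul (Real.sqrt e)).differentiableAt (hF0 x)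
        have hDu : fderiv ℝ u x = Complex.reCLM.comp (fderiv ℝ g x) :=
          (Complex.reCLM.hasFDerivAt.comp x (hgd x).hasFDerivAt).fderiv
        have hDv : fderiv ℝ v x = Complex.imCLM.comp (fderiv ℝ g x) :=
          (Complex.imCLM.hasFDerivAt.comp x (hgd x).hasFDerivAt).fderiv
        refine h3.trans_eq ?_
        rw [norm_fderiv_one_add_norm_sq_rpow_sq, Real.sq_sqrt he.le, hDu, hDv]
        simp only [sum_norm_sq_apply_single]
    have h4 := h1.trans hgrad
    have h5 : ((∫ x, ‖g x‖ ^ (2 * (n : ℝ) / (n - 2))) / M) ^ (((n : ℝ) - 2) / n) ≤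
        ((∫ x, (G x ^ n)⁻¹) / M) ^ (((n : ℝ) - 2) / n) := by
      have : 0 ≤ ∫ x, ‖g x‖ ^ (2 * (n : ℝ) / (n - 2)) := integral_nonneg fun x => by
        simp only [Pi.zero_apply]
        positivity
      gcongr
    have h6 : n * (n - 2) * M * ((∫ x, (G x ^ n)⁻¹) / M) ^ (((n : ℝ) - 2) / n) =
        ((n : ℝ) - 2) ^ 2 / 4 *
          (4 * n / (n - 2) * M * ((∫ x, (G x ^ n)⁻¹) / M) ^ (((n : ℝ) - 2) / n)) := by
      field_simp
    calc _ ≤ n * (n - 2) * M * ((∫ x, (G x ^ n)⁻¹) / M) ^ (((n : ℝ) - 2) / n) := by gcongr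
      _ ≤ ((n : ℝ) - 2) ^ 2 / 4 * (4 / ((n : ℝ) - 2) ^ 2 * (D + e * ((n - 2) ^ 2 * I))) := by
          rw [h6]
          gcongr
      _ = _ := by field_simp
  refine le_of_forall_pos_le_add fun δ hδ => ?_
  have h3 : 0 < ((n : ℝ) - 2) ^ 2 * I + 1 := by positivity
  refine (key (δ / ((n - 2) ^ 2 * I + 1)) (by positivity)).trans ?_
  gcongr
  rw [div_mul_eq_mul_div, div_le_iff₀ h3]
  nlinarith

section

variable {E : Type*} [NormedAddCommGroup E] [InnerProductSpace ℝ E]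

theorem hasFDerivAt_norm_rpow_of_ne (p : ℝ) {x : E} (hx : x ≠ 0) :
    HasFDerivAt (fun x : E => ‖x‖ ^ p) ((p * ‖x‖ ^ (p - 2)) • innerSL ℝ x) x := by
  have h0 : 0 < ‖x‖ := norm_pos_iff.2 hx
  have h := (hasStrictFDerivAt_norm_sq x).hasFDerivAt.rpow_const (p := p / 2)
    (Or.inl (by positivity))
  have e1 : ∀ (y : E) (s : ℝ), (‖y‖ ^ 2) ^ s = ‖y‖ ^ (2 * s) := fun y s => by
    rw [← Real.rpow_natCast, ← Real.rpow_mul (norm_nonneg _), Nat.cast_ofNat]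
  convert! h using 1
  · ext y
    rw [e1, mul_div_cancel₀ _ two_ne_zero]
  · rw [e1, ← Nat.cast_smul_eq_nsmul ℝ, smul_smul]
    congr 1
    rw [show 2 * (p / 2 - 1) = p - 2 by ring]
    push_cast
    ring

theorem contDiffAt_norm_rpow_of_ne (p : ℝ) {n : WithTop ℕ∞} {x : E} (hx : x ≠ 0) :
    ContDiffAt ℝ n (fun x : E => ‖x‖ ^ p) x :=
  (contDiffAt_norm ℝ hx).rpow_const_of_ne (norm_ne_zero_iff.2 hx)

theorem contDiff_of_forall_ne_zero {F : Type*} [NormedAddCommGroup F] [NormedSpace ℝ F]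
    {n : WithTop ℕ∞} {f : E → F} (h : ∀ x ≠ 0, ContDiffAt ℝ n f x)
    (h0 : f =ᶠ[nhds 0] fun _ => 0) : ContDiff ℝ n f := by
  rw [contDiff_iff_contDiffAt]
  intro x
  rcases eq_or_ne x 0 with rfl | hx
  · exact contDiffAt_const.congr_of_eventuallyEq h0
  · exact h x hx

/-- The radial map sending a vector of norm `r` to the positively proportional vector of
norm `r ^ α`. -/
noncomputable def radialPow (α : ℝ) (y : E) : E := ‖y‖ ^ (α - 1) • y

theorem norm_radialPow {α : ℝ} (hα : α ≠ 0) (y : E) : ‖radialPow α y‖ = ‖y‖ ^ α := by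
  rw [radialPow, norm_smul, Real.norm_of_nonneg (by positivity)]
  rcases eq_or_ne y 0 with rfl | hy
  · rw [norm_zero, mul_zero, Real.zero_rpow hα]
  · rw [Real.rpow_sub_one (norm_ne_zero_iff.2 hy), div_mul_cancel₀ _ (norm_ne_zero_iff.2 hy)]

theorem radialPow_ne_zero (α : ℝ) {y : E} (hy : y ≠ 0) : radialPow α y ≠ 0 :=
  smul_ne_zero (Real.rpow_pos_of_pos (norm_pos_iff.2 hy) _).ne' hy

theorem radialPow_radialPow {α β : ℝ} (h : α * β = 1) (y : E) :
    radialPow β (radialPow α y) = y := by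
  have hα : α ≠ 0 := by
    rintro rfl
    simp at h
  rcases eq_or_ne y 0 with rfl | hy
  · simp [radialPow]
  have hy0 : 0 < ‖y‖ := norm_pos_iff.2 hy
  rw [radialPow, norm_radialPow hα, radialPow, smul_smul, ← Real.rpow_mul hy0.le,
    ← Real.rpow_add hy0, show α * (β - 1) + (α - 1) = 0 by linarith, Real.rpow_zero, one_smul]

theorem continuous_radialPow {α : ℝ} (hα : 0 < α) : Continuous (radialPow α : E → E) := by
  rw [continuous_iff_continuousAt]
  intro x
  rcases eq_or_ne x 0 with rfl | hx
  · have h0 : radialPow α (0 : E) = 0 := by simp [radialPow]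
    rw [ContinuousAt, h0, tendsto_zero_iff_norm_tendsto_zero]
    simp only [norm_radialPow hα.ne']
    have : Continuous fun y : E => ‖y‖ ^ α := continuous_norm.rpow_const fun _ => Or.inr hα.le
    simpa [Real.zero_rpow hα.ne'] using this.tendsto 0
  · exact ((hasFDerivAt_norm_rpow_of_ne _ hx).continuousAt).smul continuousAt_id

theorem contDiffAt_radialPow (α : ℝ) {n : WithTop ℕ∞} {y : E} (hy : y ≠ 0) :
    ContDiffAt ℝ n (radialPow α : E → E) y :=
  (contDiffAt_norm_rpow_of_ne _ hy).smul contDiffAt_id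

theorem hasFDerivAt_radialPow (α : ℝ) {y : E} (hy : y ≠ 0) :
    HasFDerivAt (radialPow α : E → E) (‖y‖ ^ (α - 1) • (ContinuousLinearMap.id ℝ E +
      (((α - 1) * (‖y‖ ^ 2)⁻¹) • innerSL ℝ y).smulRight y)) y := by
  have hy0 : 0 < ‖y‖ := norm_pos_iff.2 hy
  have h := (hasFDerivAt_norm_rpow_of_ne (α - 1) hy).smul (hasFDerivAt_id y)
  convert! h using 1
  rw [smul_add]
  congr 1
  ext v
  simp only [smul_apply, ContinuousLinearMap.smulRight_apply, smul_eq_mul, smul_smul, id]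
  congr 1
  rw [Real.rpow_sub hy0 (α - 1) 2, Real.rpow_two]
  field_simp

theorem norm_fderiv_radialPow_le {α : ℝ} (hα : 1 ≤ α) {y : E} (hy : y ≠ 0) :
    ‖fderiv ℝ (radialPow α : E → E) y‖ ≤ α * ‖y‖ ^ (α - 1) := by
  have hy0 : 0 < ‖y‖ := norm_pos_iff.2 hy
  rw [(hasFDerivAt_radialPow α hy).fderiv, norm_smul, Real.norm_of_nonneg (by positivity), mul_comm]
  gcongr
  refine (norm_add_le _ _).trans ?_
  rw [ContinuousLinearMap.norm_smulRight_apply, norm_smul, innerSL_apply_norm,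
    Real.norm_of_nonneg (by have := sub_nonneg.2 hα; positivity)]
  have h1 : (α - 1) * (‖y‖ ^ 2)⁻¹ * ‖y‖ * ‖y‖ = α - 1 := by field_simp
  rw [h1]
  linarith [ContinuousLinearMap.norm_id_le (𝕜 := ℝ) (E := E)]

variable [FiniteDimensional ℝ E]

theorem det_fderiv_radialPow (α : ℝ) {y : E} (hy : y ≠ 0) :
    (‖y‖ ^ (α - 1) • (ContinuousLinearMap.id ℝ E +
      (((α - 1) * (‖y‖ ^ 2)⁻¹) • innerSL ℝ y).smulRight y)).det =
      α * ‖y‖ ^ ((α - 1) * Module.finrank ℝ E) := by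
  have hy0 : 0 < ‖y‖ := norm_pos_iff.2 hy
  have h1 : ((ContinuousLinearMap.id ℝ E +
      (((α - 1) * (‖y‖ ^ 2)⁻¹) • innerSL ℝ y).smulRight y : E →L[ℝ] E) : E →ₗ[ℝ] E) =
      LinearMap.transvection (((α - 1) * (‖y‖ ^ 2)⁻¹) • (innerSL ℝ y : E →ₗ[ℝ] ℝ)) y := by
    ext v
    simp [LinearMap.transvection.apply]
  rw [ContinuousLinearMap.det, ContinuousLinearMap.toLinearMap_smul, LinearMap.det_smul, h1,
    LinearMap.transvection.det, ← Real.rpow_natCast, ← Real.rpow_mul hy0.le, mul_comm]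
  congr 1
  simp only [LinearMap.smul_apply, ContinuousLinearMap.coe_coe, innerSL_apply_apply,
    real_inner_self_eq_norm_sq, smul_eq_mul]
  field_simp
  ring

variable [Nontrivial E] [MeasurableSpace E] [BorelSpace E] (μ : Measure E) [μ.IsAddHaarMeasure]

theorem integral_comp_radialPow {F : Type*} [NormedAddCommGroup F] [NormedSpace ℝ F] {α : ℝ}
    (hα : 0 < α) (f : E → F) :
    ∫ x, f x ∂μ = ∫ y, (α * ‖y‖ ^ ((α - 1) * Module.finrank ℝ E)) • f (radialPow α y) ∂μ := by
  have hαi : α * α⁻¹ = 1 := mul_inv_cancel₀ hα.ne'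
  have himg : (radialPow α : E → E) '' {0}ᶜ = {0}ᶜ := by
    ext x
    constructor
    · rintro ⟨y, hy, rfl⟩
      exact radialPow_ne_zero α hy
    · intro hx
      exact ⟨radialPow α⁻¹ x, radialPow_ne_zero _ hx,
        radialPow_radialPow (by rw [mul_comm, hαi]) x⟩
  have h := integral_image_eq_integral_abs_det_fderiv_smul μ
    (measurableSet_singleton (0 : E)).compl
    (fun y hy => (hasFDerivAt_radialPow α hy).hasFDerivWithinAt)
    (Function.LeftInverse.injective (radialPow_radialPow (E := E) hαi)).injOn f
  rw [himg, restrict_compl_singleton] at h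
  rw [h]
  refine integral_congr_ae ?_
  filter_upwards [Measure.ae_ne μ 0] with y hy
  rw [det_fderiv_radialPow α hy, abs_of_nonneg (by positivity)]

end

theorem hasCompactSupport_comp_radialPow {E F : Type*} [NormedAddCommGroup E]
    [InnerProductSpace ℝ E] [FiniteDimensional ℝ E] [Zero F] {α : ℝ} (hα : 1 ≤ α) {h : E → F}
    (hs : HasCompactSupport h) : HasCompactSupport fun y => h (radialPow α y) := by
  obtain ⟨R, hR⟩ := hs.isCompact.isBounded.subset_closedBall 0
  refine HasCompactSupport.intro (isCompact_closedBall (0 : E) (max R 1)) fun y hy => ?_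
  rw [mem_closedBall_zero_iff, not_le, max_lt_iff] at hy
  refine image_eq_zero_of_notMem_tsupport fun hm => ?_
  have h1 := hR hm
  rw [mem_closedBall_zero_iff, norm_radialPow (by positivity)] at h1
  have h2 := Real.rpow_le_rpow_of_exponent_le hy.2.le hα
  rw [Real.rpow_one] at h2
  linarith

theorem sum_norm_sq_fderiv_comp_le {n : ℕ} {h : EuclideanSpace ℝ (Fin n) → ℂ} {Ψ :
    EuclideanSpace ℝ (Fin n) → EuclideanSpace ℝ (Fin n)} {y : EuclideanSpace ℝ (Fin n)}
    (hh : DifferentiableAt ℝ h (Ψ y)) (hΨ : DifferentiableAt ℝ Ψ y) :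
    ∑ i, ‖fderiv ℝ (fun y => h (Ψ y)) y (EuclideanSpace.single i 1)‖ ^ 2 ≤
      ‖fderiv ℝ Ψ y‖ ^ 2 * ∑ i, ‖fderiv ℝ h (Ψ y) (EuclideanSpace.single i 1)‖ ^ 2 := by
  have e : fderiv ℝ (fun y => h (Ψ y)) y = (fderiv ℝ h (Ψ y)).comp (fderiv ℝ Ψ y) :=
    fderiv_comp y hh hΨ
  rw [e, sum_norm_sq_apply_single, sum_norm_sq_apply_single, mul_add, ← mul_pow, ← mul_pow,
    mul_comm ‖fderiv ℝ Ψ y‖, mul_comm ‖fderiv ℝ Ψ y‖]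
  gcongr
  · exact ContinuousLinearMap.opNorm_comp_le (Complex.reCLM.comp (fderiv ℝ h (Ψ y))) _
  · exact ContinuousLinearMap.opNorm_comp_le (Complex.imCLM.comp (fderiv ℝ h (Ψ y))) _

/-- A sharp weighted Sobolev inequality, obtained from the sharp Sobolev inequality by a radial
change of variables. -/
theorem sharp_weighted_sobolev {d : ℕ} (hd : 3 ≤ d) {β : ℝ} (hβ0 : 0 < β) (hβ1 : β ≤ 1)
    {h : EuclideanSpace ℝ (Fin d) → ℂ} (hh : ContDiff ℝ 2 h) (hs : HasCompactSupport h)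
    (h0 : h =ᶠ[nhds 0] fun _ => 0) :
    β * ((d : ℝ) * ((d : ℝ) - 2) * (∫ x : EuclideanSpace ℝ (Fin d), ((1 + ‖x‖ ^ 2) ^ d)⁻¹) *
      ((β * ∫ x, ‖x‖ ^ (-((1 - β) * (d : ℝ))) * ‖h x‖ ^ (2 * (d : ℝ) / ((d : ℝ) - 2))) /
        (∫ x : EuclideanSpace ℝ (Fin d), ((1 + ‖x‖ ^ 2) ^ d)⁻¹)) ^ (((d : ℝ) - 2) / (d : ℝ))) ≤
      ∫ x, ‖x‖ ^ (-((1 - β) * ((d : ℝ) - 2))) *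
        ∑ i, ‖fderiv ℝ h x (EuclideanSpace.single i 1)‖ ^ 2 := by
  have hd0 : (3 : ℝ) ≤ d := by exact_mod_cast hd
  have hne : Nonempty (Fin d) := ⟨⟨0, by omega⟩⟩
  obtain ⟨α, rfl⟩ : ∃ α : ℝ, β = α⁻¹ := ⟨β⁻¹, (inv_inv β).symm⟩
  have hα0 : 0 < α := inv_pos.1 hβ0
  have hα1 : 1 ≤ α := (inv_le_one₀ hα0).1 hβ1
  have hcont : Continuous (radialPow α : EuclideanSpace ℝ (Fin d) → _) := continuous_radialPow hα0
  have hr0 : radialPow α (0 : EuclideanSpace ℝ (Fin d)) = 0 := by simp [radialPow]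
  set g : EuclideanSpace ℝ (Fin d) → ℂ := fun y => h (radialPow α y) with hg
  have hgc : ContDiff ℝ 2 g := by
    refine contDiff_of_forall_ne_zero (fun x hx => ?_) ?_
    · exact (hh.contDiffAt (x := radialPow α x)).comp x (contDiffAt_radialPow α hx)
    · have : Filter.Tendsto (radialPow α) (nhds (0 : EuclideanSpace ℝ (Fin d))) (nhds 0) := by
        simpa [hr0] using hcont.tendsto 0
      exact this.eventually h0
  have hgs : HasCompactSupport g := hasCompactSupport_comp_radialPow hα1 hs
  have hS := sharp_sobolev_of_hasCompactSupport hd hgc hgs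
  have hm : (∫ x, ‖x‖ ^ (-((1 - α⁻¹) * (d : ℝ))) * ‖h x‖ ^ (2 * (d : ℝ) / ((d : ℝ) - 2))) =
      α * ∫ y, ‖g y‖ ^ (2 * (d : ℝ) / ((d : ℝ) - 2)) := by
    rw [integral_comp_radialPow volume hα0, ← integral_const_mul]
    refine integral_congr_ae ?_
    filter_upwards [Measure.ae_ne volume (0 : EuclideanSpace ℝ (Fin d))] with y hy
    have hy0 : 0 < ‖y‖ := norm_pos_iff.2 hy
    have e : ‖y‖ ^ ((α - 1) * (d : ℝ)) * ‖y‖ ^ (α * (-((1 - α⁻¹) * (d : ℝ)))) = 1 := by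
      rw [← Real.rpow_add hy0]
      convert Real.rpow_zero _ using 2
      field_simp
      ring
    rw [norm_radialPow hα0.ne', finrank_euclideanSpace_fin, smul_eq_mul, ← Real.rpow_mul hy0.le]
    linear_combination (α * ‖g y‖ ^ (2 * (d : ℝ) / ((d : ℝ) - 2))) * e
  have hD : α⁻¹ * (∫ y, ∑ i, ‖fderiv ℝ g y (EuclideanSpace.single i 1)‖ ^ 2) ≤
      ∫ x, ‖x‖ ^ (-((1 - α⁻¹) * ((d : ℝ) - 2))) *
        ∑ i, ‖fderiv ℝ h x (EuclideanSpace.single i 1)‖ ^ 2 := by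
    set S : EuclideanSpace ℝ (Fin d) → ℝ :=
      fun x => ∑ i, ‖fderiv ℝ h x (EuclideanSpace.single i 1)‖ ^ 2 with hSdef
    have hScont : Continuous S := by
      have := hh.continuous_fderiv (by norm_num)
      fun_prop
    have hSs : HasCompactSupport S := by
      refine (hs.fderiv (𝕜 := ℝ)).mono fun x hx => ?_
      contrapose! hx
      simp only [Function.mem_support, not_not] at hx ⊢
      simp [hSdef, hx]
    have hcv : (∫ x, ‖x‖ ^ (-((1 - α⁻¹) * ((d : ℝ) - 2))) * S x) =
        ∫ y, α * ‖y‖ ^ (2 * (α - 1)) * S (radialPow α y) := by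
      rw [integral_comp_radialPow volume hα0]
      refine integral_congr_ae ?_
      filter_upwards [Measure.ae_ne volume (0 : EuclideanSpace ℝ (Fin d))] with y hy
      have hy0 : 0 < ‖y‖ := norm_pos_iff.2 hy
      have e : ‖y‖ ^ ((α - 1) * (d : ℝ)) * ‖y‖ ^ (α * (-((1 - α⁻¹) * ((d : ℝ) - 2)))) =
          ‖y‖ ^ (2 * (α - 1)) := by
        rw [← Real.rpow_add hy0]
        congr 1
        field_simp
        ring
      rw [norm_radialPow hα0.ne', finrank_euclideanSpace_fin, smul_eq_mul, ← Real.rpow_mul hy0.le]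
      linear_combination (α * S (radialPow α y)) * e
    rw [hcv, ← integral_const_mul]
    refine integral_mono_of_nonneg (Filter.Eventually.of_forall fun y => ?_) ?_ ?_
    · simp only [Pi.zero_apply]
      positivity
    · refine Continuous.integrable_of_hasCompactSupport ?_
        (HasCompactSupport.mul_left (hasCompactSupport_comp_radialPow hα1 hSs))
      refine (continuous_const.mul ?_).mul (hScont.comp hcont)
      exact continuous_norm.rpow_const fun _ => Or.inr (by linarith)
    · filter_upwards [Measure.ae_ne volume (0 : EuclideanSpace ℝ (Fin d))] with y hy
      have h1 := sum_norm_sq_fderiv_comp_le (hh.differentiable (by norm_num) (radialPow α y))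
        ((contDiffAt_radialPow (n := 1) α hy).differentiableAt (by norm_num))
      have hS0 : 0 ≤ S (radialPow α y) := by positivity
      have h2 : ‖fderiv ℝ (radialPow α) y‖ ^ 2 ≤ α ^ 2 * ‖y‖ ^ (2 * (α - 1)) := by
        rw [mul_comm 2, Real.rpow_mul (norm_nonneg _), Real.rpow_two, ← mul_pow]
        exact pow_le_pow_left₀ (norm_nonneg _) (norm_fderiv_radialPow_le hα1 hy) 2
      calc α⁻¹ * _ ≤ α⁻¹ * (α ^ 2 * ‖y‖ ^ (2 * (α - 1)) * S (radialPow α y)) := by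
            gcongr
            exact h1.trans (mul_le_mul_of_nonneg_right h2 hS0)
        _ = _ := by field_simp
  rw [hm, inv_mul_cancel_left₀ hα0.ne']
  exact (mul_le_mul_of_nonneg_left hS hβ0.le).trans hD

theorem integral_fderiv_apply_eq_zero {E : Type*} [NormedAddCommGroup E] [InnerProductSpace ℝ E]
    [FiniteDimensional ℝ E] [MeasurableSpace E] [BorelSpace E] (μ : Measure E)
    [μ.IsAddHaarMeasure] {θ : E → ℝ} (hθ : ContDiff ℝ 1 θ) (hs : HasCompactSupport θ) (v : E) :
    Integrable (fun x => fderiv ℝ θ x v) μ ∧ ∫ x, fderiv ℝ θ x v ∂μ = 0 := by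
  have hc : Continuous fun x => fderiv ℝ θ x v := by
    have := hθ.continuous_fderiv (by norm_num)
    fun_prop
  have hi : Integrable (fun x => fderiv ℝ θ x v) μ :=
    hc.integrable_of_hasCompactSupport (hs.fderiv_apply (𝕜 := ℝ) v)
  have h := integral_mul_fderiv_eq_neg_fderiv_mul_of_integrable (μ := μ) (f := fun _ : E => (1 : ℝ))
    (g := θ) (v := v) (by simp) (by simpa using hi)
    (by simpa using hθ.continuous.integrable_of_hasCompactSupport hs)
    (fun x _ => differentiableAt_const _) (fun x _ => hθ.differentiable (by norm_num) x)
  exact ⟨hi, by simpa using h⟩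

theorem sum_norm_sq_fderiv_norm_rpow_smul {d : ℕ} (γ : ℝ)
    {f : EuclideanSpace ℝ (Fin d) → ℂ} {x : EuclideanSpace ℝ (Fin d)} (hx : x ≠ 0)
    (hf : DifferentiableAt ℝ f x) :
    ‖x‖ ^ (-(2 * γ)) *
      ∑ i, ‖fderiv ℝ (fun x => ‖x‖ ^ γ • f x) x (EuclideanSpace.single i 1)‖ ^ 2 =
      (∑ i, ‖fderiv ℝ f x (EuclideanSpace.single i 1)‖ ^ 2) +
        (γ ^ 2 - γ * ((d : ℝ) - 2)) / ‖x‖ ^ 2 * ‖f x‖ ^ 2 +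
      γ * ∑ i, fderiv ℝ (fun x => x i * (‖x‖ ^ (-2 : ℝ) * ‖f x‖ ^ 2)) x
        (EuclideanSpace.single i 1) := by
  have hx0 : 0 < ‖x‖ := norm_pos_iff.2 hx
  have hr2 : ∑ i, x i ^ 2 = ‖x‖ ^ 2 := by
    rw [EuclideanSpace.norm_sq_eq]
    simp
  have e0 : ∀ i, inner ℝ x (EuclideanSpace.single i (1 : ℝ)) = x i := fun i => by
    simp [EuclideanSpace.inner_single_right]
  have em2 : ‖x‖ ^ (-2 : ℝ) = (‖x‖ ^ 2)⁻¹ := by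
    rw [Real.rpow_neg hx0.le, Real.rpow_two]
  have em4 : ‖x‖ ^ (-2 - 2 : ℝ) = (‖x‖ ^ 2)⁻¹ ^ 2 := by
    rw [← em2, ← Real.rpow_natCast, ← Real.rpow_mul hx0.le]
    norm_num
  have hh : ∀ i, ‖x‖ ^ (-(2 * γ)) *
      ‖fderiv ℝ (fun x => ‖x‖ ^ γ • f x) x (EuclideanSpace.single i 1)‖ ^ 2 =
      ‖fderiv ℝ f x (EuclideanSpace.single i 1) + (γ * (‖x‖ ^ 2)⁻¹ * x i) • f x‖ ^ 2 := fun i => by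
    have h1 : fderiv ℝ (fun x => ‖x‖ ^ γ • f x) x (EuclideanSpace.single i 1) =
        ‖x‖ ^ γ • (fderiv ℝ f x (EuclideanSpace.single i 1) +
          (γ * (‖x‖ ^ 2)⁻¹ * x i) • f x) := by
      have := (HasFDerivAt.fun_smul (hasFDerivAt_norm_rpow_of_ne γ hx) hf.hasFDerivAt).fderiv
      rw [this]
      simp only [add_apply, smul_apply, ContinuousLinearMap.smulRight_apply, innerSL_apply_apply,
        e0, smul_add, smul_smul, Real.rpow_sub hx0, Real.rpow_two, smul_eq_mul]
      congr 2
      ring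
    rw [h1, norm_smul, mul_pow, Real.norm_of_nonneg (by positivity), ← Real.rpow_natCast,
      ← Real.rpow_mul hx0.le, ← mul_assoc, ← Real.rpow_add hx0]
    rw [show -(2 * γ) + γ * ((2 : ℕ) : ℝ) = 0 by push_cast; ring, Real.rpow_zero, one_mul]
  have hθ : ∀ i, fderiv ℝ (fun x => x i * (‖x‖ ^ (-2 : ℝ) * ‖f x‖ ^ 2)) x
        (EuclideanSpace.single i 1) = (‖x‖ ^ 2)⁻¹ * ‖f x‖ ^ 2
          - 2 * x i ^ 2 * (‖x‖ ^ 2)⁻¹ ^ 2 * ‖f x‖ ^ 2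
          + x i * (‖x‖ ^ 2)⁻¹ * (2 * inner ℝ (f x) (fderiv ℝ f x (EuclideanSpace.single i 1))) :=
      fun i => by
    have h1 : HasFDerivAt (fun x : EuclideanSpace ℝ (Fin d) => x i)
        (EuclideanSpace.proj i : EuclideanSpace ℝ (Fin d) →L[ℝ] ℝ) x :=
      (EuclideanSpace.proj i : EuclideanSpace ℝ (Fin d) →L[ℝ] ℝ).hasFDerivAt
    have h2 := (h1.mul ((hasFDerivAt_norm_rpow_of_ne (-2) hx).mul hf.hasFDerivAt.norm_sq)).fderiv
    rw [show (fun x : EuclideanSpace ℝ (Fin d) => x i * (‖x‖ ^ (-2 : ℝ) * ‖f x‖ ^ 2)) =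
      (fun x => x i) * ((fun x => ‖x‖ ^ (-2 : ℝ)) * fun x => ‖f x‖ ^ 2) from rfl, h2]
    simp [e0, em2, em4]
    ring
  rw [Finset.mul_sum, Finset.sum_congr rfl fun i _ => hh i, Finset.sum_congr rfl fun i _ => hθ i]
  have hexp : ∀ i, ‖fderiv ℝ f x (EuclideanSpace.single i 1) +
      (γ * (‖x‖ ^ 2)⁻¹ * x i) • f x‖ ^ 2 = ‖fderiv ℝ f x (EuclideanSpace.single i 1)‖ ^ 2
        + γ * (x i * (‖x‖ ^ 2)⁻¹ *
          (2 * inner ℝ (f x) (fderiv ℝ f x (EuclideanSpace.single i 1))))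
        + x i ^ 2 * (γ ^ 2 * (‖x‖ ^ 2)⁻¹ ^ 2 * ‖f x‖ ^ 2) := fun i => by
    rw [norm_add_sq_real, real_inner_smul_right, norm_smul, mul_pow, Real.norm_eq_abs, sq_abs,
      real_inner_comm]
    ring
  rw [Finset.sum_congr rfl fun i _ => hexp i]
  have hsq : ∀ i, 2 * x i ^ 2 * (‖x‖ ^ 2)⁻¹ ^ 2 * ‖f x‖ ^ 2 =
    x i ^ 2 * (2 * (‖x‖ ^ 2)⁻¹ ^ 2 * ‖f x‖ ^ 2) := fun i => by ring
  simp only [Finset.sum_add_distrib, Finset.sum_sub_distrib, hsq, ← Finset.sum_mul, hr2,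
    ← Finset.mul_sum, Finset.sum_const, Finset.card_univ, Fintype.card_fin, nsmul_eq_mul]
  generalize (∑ i, x i * (‖x‖ ^ 2)⁻¹ *
    (2 * inner ℝ (f x) (fderiv ℝ f x (EuclideanSpace.single i 1)))) = T
  field_simp
  ring

theorem integrable_div_norm_sq_mul {d : ℕ} {f : EuclideanSpace ℝ (Fin d) → ℂ}
    (hf : Continuous f) (hs : HasCompactSupport f) (h0 : f =ᶠ[nhds 0] fun _ => 0) (c : ℝ) :
    Integrable fun x => c / ‖x‖ ^ 2 * ‖f x‖ ^ 2 := by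
  refine Continuous.integrable_of_hasCompactSupport ?_ ?_
  · rw [continuous_iff_continuousAt]
    intro x
    rcases eq_or_ne x 0 with rfl | hx
    · refine (continuousAt_const (y := (0 : ℝ))).congr ?_
      filter_upwards [h0] with y hy
      simp [hy]
    · have : ‖x‖ ^ 2 ≠ 0 := by simpa using hx
      fun_prop (disch := assumption)
  · refine hs.mono fun x hx => ?_
    contrapose! hx
    simp only [Function.mem_support, not_not] at hx ⊢
    simp [hx]

theorem integrable_sum_norm_sq_fderiv {d : ℕ} {f : EuclideanSpace ℝ (Fin d) → ℂ}
    (hf : ContDiff ℝ 2 f) (hs : HasCompactSupport f) :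
    Integrable fun x => ∑ i, ‖fderiv ℝ f x (EuclideanSpace.single i 1)‖ ^ 2 := by
  refine Continuous.integrable_of_hasCompactSupport ?_ ?_
  · have := hf.continuous_fderiv (by norm_num)
    fun_prop
  · refine (hs.fderiv (𝕜 := ℝ)).mono fun x hx => ?_
    contrapose! hx
    simp only [Function.mem_support, not_not] at hx ⊢
    simp [hx]

/-- The ground state substitution `h = ‖x‖ ^ γ f` turns the Hardy form into a weighted Dirichlet
form. -/
theorem integral_norm_rpow_mul_sum_norm_sq_fderiv {d : ℕ} (γ : ℝ)
    {f : EuclideanSpace ℝ (Fin d) → ℂ} (hf : ContDiff ℝ 2 f) (hs : HasCompactSupport f)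
    (h0 : f =ᶠ[nhds 0] fun _ => 0) (hd : 1 ≤ d) :
    ∫ x, ‖x‖ ^ (-(2 * γ)) *
      ∑ i, ‖fderiv ℝ (fun x => ‖x‖ ^ γ • f x) x (EuclideanSpace.single i 1)‖ ^ 2 =
      ∫ x, ((∑ i, ‖fderiv ℝ f x (EuclideanSpace.single i 1)‖ ^ 2) +
        (γ ^ 2 - γ * ((d : ℝ) - 2)) / ‖x‖ ^ 2 * ‖f x‖ ^ 2) := by
  have hne : Nonempty (Fin d) := ⟨⟨0, by omega⟩⟩
  have hθ : ∀ i, Integrable (fun x => fderiv ℝ (fun x : EuclideanSpace ℝ (Fin d) =>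
        x i * (‖x‖ ^ (-2 : ℝ) * ‖f x‖ ^ 2)) x (EuclideanSpace.single i 1)) ∧
      ∫ x, fderiv ℝ (fun x : EuclideanSpace ℝ (Fin d) =>
        x i * (‖x‖ ^ (-2 : ℝ) * ‖f x‖ ^ 2)) x (EuclideanSpace.single i 1) = 0 := fun i => by
    refine integral_fderiv_apply_eq_zero volume (contDiff_of_forall_ne_zero (fun x hx => ?_) ?_)
      ?_ _
    · have h1 : ContDiffAt ℝ 1 (fun x : EuclideanSpace ℝ (Fin d) => x i) x := by fun_prop
      exact h1.mul ((contDiffAt_norm_rpow_of_ne _ hx).mul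
        ((hf.contDiffAt.of_le (by norm_num)).norm_sq ℝ))
    · filter_upwards [h0] with y hy
      simp [hy]
    · refine hs.mono fun x hx => ?_
      contrapose! hx
      simp only [Function.mem_support, not_not] at hx ⊢
      simp [hx]
  have hS := integrable_sum_norm_sq_fderiv hf hs
  rw [integral_congr_ae (g := fun x => (((∑ i, ‖fderiv ℝ f x (EuclideanSpace.single i 1)‖ ^ 2) +
        (γ ^ 2 - γ * ((d : ℝ) - 2)) / ‖x‖ ^ 2 * ‖f x‖ ^ 2) +
      γ * ∑ i, fderiv ℝ (fun x => x i * (‖x‖ ^ (-2 : ℝ) * ‖f x‖ ^ 2)) x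
        (EuclideanSpace.single i 1))), integral_add, integral_const_mul,
        integral_finsetSum _ fun i _ => (hθ i).1]
  · rw [Finset.sum_eq_zero fun i _ => (hθ i).2, mul_zero, add_zero]
  · exact hS.add (integrable_div_norm_sq_mul hf.continuous hs h0 _)
  · exact (integrable_finsetSum _ fun i _ => (hθ i).1).const_mul _
  · filter_upwards [Measure.ae_ne volume (0 : EuclideanSpace ℝ (Fin d))] with x hx
    exact sum_norm_sq_fderiv_norm_rpow_smul γ hx (hf.differentiable (by norm_num) x)

theorem sum_sq_fderiv_add_groundState {d : ℕ} {β C : ℝ}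
    {W : EuclideanSpace ℝ (Fin d) → ℝ}
    (hW : ∀ x, W x = C * (‖x‖ ^ (β - 1) / (1 + ‖x‖ ^ (2 * β))) ^ (((d : ℝ) - 2) / 2))
    {x : EuclideanSpace ℝ (Fin d)} (hx : x ≠ 0) :
    (∑ i, (fderiv ℝ W x (EuclideanSpace.single i 1)) ^ 2) +
      (((d : ℝ) - 2) / 2) ^ 2 * (β ^ 2 - 1) / ‖x‖ ^ 2 * (W x) ^ 2 =
      C ^ 2 * (2 * β * (((d : ℝ) - 2) / 2) ^ 2) * (‖x‖ ^ ((β - 1) * (d : ℝ)) *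
        ((1 + (‖x‖ ^ β) ^ 2) ^ d)⁻¹ *
          ((1 + β) * (‖x‖ ^ β) ^ 2 - (1 - β) * ((‖x‖ ^ β) ^ 2)⁻¹)) := by
  set N : ℝ := ((d : ℝ) - 2) / 2 with hN
  have hrep : ∀ z : EuclideanSpace ℝ (Fin d), z ≠ 0 →
      W z = C * (‖z‖ ^ (1 - β) + ‖z‖ ^ (1 + β)) ^ (-N) := fun z hz => by
    have hz0 : 0 < ‖z‖ := norm_pos_iff.2 hz
    have e : ‖z‖ ^ (β - 1) / (1 + ‖z‖ ^ (2 * β)) = (‖z‖ ^ (1 - β) + ‖z‖ ^ (1 + β))⁻¹ := by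
      rw [show 1 + β = (1 - β) + 2 * β by ring, Real.rpow_add hz0,
        show β - 1 = -(1 - β) by ring, Real.rpow_neg hz0.le]
      have : 0 < ‖z‖ ^ (1 - β) := by positivity
      field_simp
    rw [hW, e, Real.rpow_neg (by positivity), Real.inv_rpow (by positivity)]
  have hx0 : 0 < ‖x‖ := norm_pos_iff.2 hx
  have hψ : 0 < ‖x‖ ^ (1 - β) + ‖x‖ ^ (1 + β) := by positivity
  have hD := (((hasFDerivAt_norm_rpow_of_ne (1 - β) hx).fun_add
    (hasFDerivAt_norm_rpow_of_ne (1 + β) hx)).rpow_const (p := -N) (Or.inl hψ.ne')).const_mul C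
  have hWD : fderiv ℝ W x = _ := (hD.congr_of_eventuallyEq (by
    filter_upwards [isOpen_ne.mem_nhds hx] with z hz
    exact hrep z hz)).fderiv
  rw [sum_sq_apply_single, hWD, hrep x hx, ← add_smul, smul_smul, smul_smul, norm_smul, mul_pow,
    innerSL_apply_norm, Real.norm_eq_abs, sq_abs]
  have hs : 0 < ‖x‖ ^ β := by positivity
  have e1 : ‖x‖ ^ (1 - β) = ‖x‖ / ‖x‖ ^ β := by rw [Real.rpow_sub hx0, Real.rpow_one]
  have e2 : ‖x‖ ^ (1 + β) = ‖x‖ * ‖x‖ ^ β := by rw [Real.rpow_add hx0, Real.rpow_one]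
  have e3 : ‖x‖ ^ (1 - β - 2) = (‖x‖ * ‖x‖ ^ β)⁻¹ := by
    rw [← e2, ← Real.rpow_neg hx0.le]
    congr 1
    ring
  have e4 : ‖x‖ ^ (1 + β - 2) = ‖x‖ ^ β / ‖x‖ := by
    rw [show 1 + β - 2 = β - 1 by ring, Real.rpow_sub hx0, Real.rpow_one]
  have e5 : ‖x‖ ^ ((β - 1) * (d : ℝ)) = (‖x‖ ^ β / ‖x‖) ^ d := by
    rw [Real.rpow_mul hx0.le, Real.rpow_natCast, Real.rpow_sub hx0, Real.rpow_one]
  set ψ : ℝ := ‖x‖ ^ (1 - β) + ‖x‖ ^ (1 + β) with hψdef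
  have e6 : (ψ ^ (-N - 1)) ^ 2 = (ψ ^ d)⁻¹ := by
    rw [← Real.rpow_natCast, ← Real.rpow_mul hψ.le, ← Real.rpow_natCast, ← Real.rpow_neg hψ.le]
    congr 1
    rw [hN]
    push_cast
    ring
  have e7 : ψ ^ (-N) = ψ ^ (-N - 1) * ψ := by
    rw [← Real.rpow_add_one hψ.ne']
    congr 1
    ring
  have e8 : (ψ ^ d)⁻¹ = (‖x‖ ^ β / ‖x‖) ^ d * ((1 + (‖x‖ ^ β) ^ 2) ^ d)⁻¹ := by
    rw [← inv_pow, ← inv_pow, ← mul_pow, hψdef, e1, e2]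
    congr 1
    field_simp
  rw [e5, ← e8, ← e6, e7, e3, e4, hψdef, e1, e2, ← e1, ← e2, ← hψdef]
  generalize ψ ^ (-N - 1) = P
  rw [hψdef, e1, e2]
  generalize ‖x‖ ^ β = s at *
  field_simp
  ring

/-- The value of the Hardy form at the ground state. -/
theorem integral_sum_sq_fderiv_add_groundState {d : ℕ} (hd : 3 ≤ d) {β C : ℝ} (hβ : 0 < β)
    {W : EuclideanSpace ℝ (Fin d) → ℝ}
    (hW : ∀ x, W x = C * (‖x‖ ^ (β - 1) / (1 + ‖x‖ ^ (2 * β))) ^ (((d : ℝ) - 2) / 2)) :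
    ∫ x, ((∑ i, (fderiv ℝ W x (EuclideanSpace.single i 1)) ^ 2) +
      (((d : ℝ) - 2) / 2) ^ 2 * (β ^ 2 - 1) / ‖x‖ ^ 2 * (W x) ^ 2) =
      C ^ 2 * (β * ((d : ℝ) * ((d : ℝ) - 2))) *
        ∫ x : EuclideanSpace ℝ (Fin d), ((1 + ‖x‖ ^ 2) ^ d)⁻¹ := by
  have hd0 : (3 : ℝ) ≤ d := by exact_mod_cast hd
  have hne : Nonempty (Fin d) := ⟨⟨0, by omega⟩⟩
  have hα : 0 < β⁻¹ := inv_pos.2 hβ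
  have hcv : ∫ x : EuclideanSpace ℝ (Fin d), (‖x‖ ^ ((β - 1) * (d : ℝ)) *
        ((1 + (‖x‖ ^ β) ^ 2) ^ d)⁻¹ *
          ((1 + β) * (‖x‖ ^ β) ^ 2 - (1 - β) * ((‖x‖ ^ β) ^ 2)⁻¹)) =
      ∫ y : EuclideanSpace ℝ (Fin d), β⁻¹ * ((1 + β) * (‖y‖ ^ 2 * ((1 + ‖y‖ ^ 2) ^ d)⁻¹)
        - (1 - β) * ((‖y‖ ^ 2)⁻¹ * ((1 + ‖y‖ ^ 2) ^ d)⁻¹)) := by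
    rw [integral_comp_radialPow volume hα]
    refine integral_congr_ae ?_
    filter_upwards [Measure.ae_ne volume (0 : EuclideanSpace ℝ (Fin d))] with y hy
    have hy0 : 0 < ‖y‖ := norm_pos_iff.2 hy
    have e : ‖y‖ ^ ((β⁻¹ - 1) * (d : ℝ)) * ‖y‖ ^ (β⁻¹ * ((β - 1) * (d : ℝ))) = 1 := by
      rw [← Real.rpow_add hy0]
      convert Real.rpow_zero _ using 2
      field_simp
      ring
    rw [norm_radialPow hα.ne', finrank_euclideanSpace_fin, smul_eq_mul, ← Real.rpow_mul hy0.le,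
      ← Real.rpow_mul hy0.le, inv_mul_cancel₀ hβ.ne', Real.rpow_one]
    linear_combination (β⁻¹ * ((1 + ‖y‖ ^ 2) ^ d)⁻¹ *
      ((1 + β) * ‖y‖ ^ 2 - (1 - β) * (‖y‖ ^ 2)⁻¹)) * e
  rw [integral_congr_ae (g := fun x => C ^ 2 * (2 * β * (((d : ℝ) - 2) / 2) ^ 2) *
    (‖x‖ ^ ((β - 1) * (d : ℝ)) * ((1 + (‖x‖ ^ β) ^ 2) ^ d)⁻¹ *
      ((1 + β) * (‖x‖ ^ β) ^ 2 - (1 - β) * ((‖x‖ ^ β) ^ 2)⁻¹))), integral_const_mul, hcv,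
    integral_const_mul, integral_sub ((integrable_norm_sq_mul_inv_pow hd).const_mul _)
      ((integrable_inv_norm_sq_mul_inv_pow hd).const_mul _), integral_const_mul,
    integral_const_mul, integral_norm_sq_mul_inv_pow hd, integral_inv_norm_sq_mul_inv_pow hd]
  · have : (d : ℝ) - 2 ≠ 0 := by linarith
    field_simp
    ring
  · filter_upwards [Measure.ae_ne volume (0 : EuclideanSpace ℝ (Fin d))] with x hx
    exact sum_sq_fderiv_add_groundState hW hx

/-- The Hardy–Sobolev inequality with sharp constant, for the form with coefficient
`((d - 2) / 2) ^ 2 * (β ^ 2 - 1)`. -/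
theorem sharp_hardy_sobolev {d : ℕ} (hd : 3 ≤ d) {β : ℝ} (hβ0 : 0 < β) (hβ1 : β ≤ 1)
    {f : EuclideanSpace ℝ (Fin d) → ℂ} (hf : ContDiff ℝ 2 f) (hs : HasCompactSupport f)
    (h0 : f =ᶠ[nhds 0] fun _ => 0) :
    β * ((d : ℝ) * ((d : ℝ) - 2) * (∫ x : EuclideanSpace ℝ (Fin d), ((1 + ‖x‖ ^ 2) ^ d)⁻¹) *
      ((β * ∫ x, ‖f x‖ ^ (2 * (d : ℝ) / ((d : ℝ) - 2))) /
        (∫ x : EuclideanSpace ℝ (Fin d), ((1 + ‖x‖ ^ 2) ^ d)⁻¹)) ^ (((d : ℝ) - 2) / (d : ℝ))) ≤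
      ∫ x, ((∑ i, ‖fderiv ℝ f x (EuclideanSpace.single i 1)‖ ^ 2) +
        (((d : ℝ) - 2) / 2) ^ 2 * (β ^ 2 - 1) / ‖x‖ ^ 2 * ‖f x‖ ^ 2) := by
  have hd0 : (3 : ℝ) ≤ d := by exact_mod_cast hd
  have hne : Nonempty (Fin d) := ⟨⟨0, by omega⟩⟩
  set γ : ℝ := (1 - β) * (((d : ℝ) - 2) / 2) with hγ
  have hh0 : (fun x => ‖x‖ ^ γ • f x) =ᶠ[nhds 0] fun _ => 0 := by
    filter_upwards [h0] with x hx
    simp [hx]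
  have hh : ContDiff ℝ 2 fun x => ‖x‖ ^ γ • f x := by
    refine contDiff_of_forall_ne_zero (fun x hx => ?_) ?_
    · exact (contDiffAt_norm_rpow_of_ne γ hx).smul hf.contDiffAt
    · exact hh0
  have hm : (∫ x, ‖x‖ ^ (-((1 - β) * (d : ℝ))) *
      ‖‖x‖ ^ γ • f x‖ ^ (2 * (d : ℝ) / ((d : ℝ) - 2))) =
      ∫ x, ‖f x‖ ^ (2 * (d : ℝ) / ((d : ℝ) - 2)) := by
    refine integral_congr_ae ?_
    filter_upwards [Measure.ae_ne volume (0 : EuclideanSpace ℝ (Fin d))] with x hx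
    have hx0 : 0 < ‖x‖ := norm_pos_iff.2 hx
    have hd2 : (d : ℝ) - 2 ≠ 0 := by linarith
    rw [norm_smul, Real.norm_of_nonneg (by positivity),
      Real.mul_rpow (by positivity) (by positivity), ← Real.rpow_mul hx0.le, ← mul_assoc,
      ← Real.rpow_add hx0, show -((1 - β) * (d : ℝ)) + γ * (2 * (d : ℝ) / ((d : ℝ) - 2)) = 0 by
        rw [hγ]
        field_simp
        ring, Real.rpow_zero, one_mul]
  have hhs : HasCompactSupport fun x => ‖x‖ ^ γ • f x := by
    refine hs.mono fun x hx => ?_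
    contrapose! hx
    simp only [Function.mem_support, not_not] at hx ⊢
    simp [hx]
  have h := sharp_weighted_sobolev hd hβ0 hβ1 hh hhs hh0
  rw [show (1 - β) * ((d : ℝ) - 2) = 2 * γ by rw [hγ]; ring,
    integral_norm_rpow_mul_sum_norm_sq_fderiv γ hf hs h0 (by omega),
    show γ ^ 2 - γ * ((d : ℝ) - 2) = (((d : ℝ) - 2) / 2) ^ 2 * (β ^ 2 - 1) by rw [hγ]; ring] at h
  rwa [hm] at h

/-- Sharp Sobolev embedding in energy-trapping form: with
`W = W_{min(a,0)}` and `K = Q_{min(a,0)}(W)`, every smooth compactly supported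
`f` (supported away from the origin) satisfies
`2E_a(f)/K ≥ y - ((d-2)/d) y^{d/(d-2)}` where `y = Q_a(f)/K`. -/
theorem sharp_sobolev_energy_form
    (d : ℕ) (hd : 3 ≤ d) (a : ℝ) (ha : -(((d : ℝ) - 2) / 2) ^ 2 < a)
    (β : ℝ) (hβ : β = Real.sqrt (1 + 4 * min a 0 / ((d : ℝ) - 2) ^ 2))
    (W : EuclideanSpace ℝ (Fin d) → ℝ)
    (hW : ∀ x, W x = ((d : ℝ) * ((d : ℝ) - 2) * β ^ 2) ^ (((d : ℝ) - 2) / 4) *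
        (‖x‖ ^ (β - 1) / (1 + ‖x‖ ^ (2 * β))) ^ (((d : ℝ) - 2) / 2))
    (K : ℝ)
    (hK : K = ∫ x : EuclideanSpace ℝ (Fin d),
        ((∑ i, (fderiv ℝ W x (EuclideanSpace.single i 1)) ^ 2)
          + min a 0 / ‖x‖ ^ 2 * (W x) ^ 2))
    (f : EuclideanSpace ℝ (Fin d) → ℂ)
    (hf : ContDiff ℝ (⊤ : ℕ∞) f) (hsupp : HasCompactSupport f)
    (h0 : (0 : EuclideanSpace ℝ (Fin d)) ∉ tsupport f)
    (Qf Ef y : ℝ)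
    (hQf : Qf = ∫ x : EuclideanSpace ℝ (Fin d),
        ((∑ i, ‖fderiv ℝ f x (EuclideanSpace.single i 1)‖ ^ 2)
          + a / ‖x‖ ^ 2 * ‖f x‖ ^ 2))
    (hEf : Ef = (1 / 2) * Qf - (((d : ℝ) - 2) / (2 * (d : ℝ))) *
        ∫ x : EuclideanSpace ℝ (Fin d), ‖f x‖ ^ (2 * (d : ℝ) / ((d : ℝ) - 2)))
    (hy : y = Qf / K) :
    2 * Ef / K ≥ y - (((d : ℝ) - 2) / (d : ℝ)) * y ^ ((d : ℝ) / ((d : ℝ) - 2)) := by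
  have hd0 : (3 : ℝ) ≤ d := by exact_mod_cast hd
  have hd2 : 0 < (d : ℝ) - 2 := by linarith
  have hβpos : 0 < 1 + 4 * min a 0 / ((d : ℝ) - 2) ^ 2 := by
    have hmin : -(((d : ℝ) - 2) / 2) ^ 2 < min a 0 :=
      lt_min ha (neg_lt_zero.2 (by positivity))
    have : -1 < 4 * min a 0 / ((d : ℝ) - 2) ^ 2 := by
      rw [lt_div_iff₀ (by positivity)]
      nlinarith
    linarith
  have hβ0 : 0 < β := hβ ▸ Real.sqrt_pos.2 hβpos
  have hβsq : β ^ 2 = 1 + 4 * min a 0 / ((d : ℝ) - 2) ^ 2 := by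
    rw [hβ, Real.sq_sqrt hβpos.le]
  have hc : min a 0 = (((d : ℝ) - 2) / 2) ^ 2 * (β ^ 2 - 1) := by
    rw [hβsq]
    field_simp
    ring
  have hβ1 : β ≤ 1 := by
    rw [hβ, Real.sqrt_le_one]
    have : 4 * min a 0 / ((d : ℝ) - 2) ^ 2 ≤ 0 :=
      div_nonpos_of_nonpos_of_nonneg (by linarith [min_le_right a 0]) (by positivity)
    linarith
  have hfz : f =ᶠ[nhds 0] fun _ => 0 := notMem_tsupport_iff_eventuallyEq.1 h0
  have hf2 : ContDiff ℝ 2 f := by exact_mod_cast contDiff_infty.1 hf 2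
  have hS := sharp_hardy_sobolev hd hβ0 hβ1 hf2 hsupp hfz
  rw [hc, integral_sum_sq_fderiv_add_groundState hd hβ0 hW] at hK
  have hM := integral_inv_one_add_norm_sq_pow_pos hd
  have hgrad := integrable_sum_norm_sq_fderiv hf2 hsupp
  have hmono : ∫ x, ((∑ i, ‖fderiv ℝ f x (EuclideanSpace.single i 1)‖ ^ 2) +
        (((d : ℝ) - 2) / 2) ^ 2 * (β ^ 2 - 1) / ‖x‖ ^ 2 * ‖f x‖ ^ 2) ≤ Qf := by
    rw [hQf, ← hc]
    refine integral_mono (hgrad.add (integrable_div_norm_sq_mul hf2.continuous hsupp hfz _))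
      (hgrad.add (integrable_div_norm_sq_mul hf2.continuous hsupp hfz _)) fun x => ?_
    have := min_le_left a 0
    dsimp only
    gcongr
  have hm0 : 0 ≤ ∫ x, ‖f x‖ ^ (2 * (d : ℝ) / ((d : ℝ) - 2)) :=
    integral_nonneg fun x => by
      simp only [Pi.zero_apply]
      positivity
  have hSQ := hS.trans hmono
  clear hS hmono hQf
  generalize (∫ x : EuclideanSpace ℝ (Fin d), ((1 + ‖x‖ ^ 2) ^ d)⁻¹) = M at *
  generalize (∫ x, ‖f x‖ ^ (2 * (d : ℝ) / ((d : ℝ) - 2))) = m at *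
  set D : ℝ := (d : ℝ) * ((d : ℝ) - 2) * β ^ 2 with hD
  have hD0 : 0 < D := by positivity
  have hC : (D ^ (((d : ℝ) - 2) / 4)) ^ 2 = D ^ (((d : ℝ) - 2) / 2) := by
    rw [← Real.rpow_natCast, ← Real.rpow_mul hD0.le]
    congr 1
    push_cast
    ring
  have hCD : (D ^ (((d : ℝ) - 2) / 2) * D) ^ (((d : ℝ) - 2) / (d : ℝ)) =
      D ^ (((d : ℝ) - 2) / 2) := by
    rw [← Real.rpow_add_one hD0.ne', ← Real.rpow_mul hD0.le]
    congr 1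
    field_simp
    ring
  rw [hC] at hK
  have hC0 : 0 < D ^ (((d : ℝ) - 2) / 2) := by positivity
  generalize D ^ (((d : ℝ) - 2) / 2) = B at *
  have hK0 : 0 < K := by
    rw [hK]
    positivity
  have hmK : (m / K) ^ (((d : ℝ) - 2) / (d : ℝ)) ≤ y := by
    have e : m / K = β * m / M / (B * D) := by
      rw [hK, hD]
      field_simp
    rw [hy, e, Real.div_rpow (by positivity) (by positivity), hCD, le_div_iff₀ hK0]
    refine le_trans (le_of_eq ?_) hSQ
    rw [hK]
    field_simp
  have hle : m / K ≤ y ^ ((d : ℝ) / ((d : ℝ) - 2)) := by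
    have h1 := Real.rpow_le_rpow (by positivity) hmK (by positivity : 0 ≤ (d : ℝ) / ((d : ℝ) - 2))
    rwa [← Real.rpow_mul (by positivity), div_mul_div_cancel₀ (by positivity), div_self hd2.ne',
      Real.rpow_one] at h1
  have hE : 2 * Ef / K = y - ((d : ℝ) - 2) / (d : ℝ) * (m / K) := by
    rw [hEf, hy]
    field_simp
  rw [hE, ge_iff_le]
  gcongr
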